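/- Inhomogeneous perturbed collapsing estimate: for every 0 < ε < 1/2 with σ := (3/2−ε)·ε, there exist constants C = C(ε) and c = c(ε) > 0 such that for every 0 < T ≤ 1, every Schwartz Γ₀, and every Schwartz F, the Duhamel solution Γ of 𝐒_±Γ = F with Γ(0)=Γ₀ satisfies ‖ |∇_x|^{1/2−ε} ρ_Γ ‖_{L²([0,T]×ℝ_x)} ≤ C T^c ( ‖ |∇_{x,y}|^{σ} Γ ‖_{L^∞([0,T]; L²(ℝ²))} + ‖ |∇_{x,y}|^{σ} F ‖_{L¹([0,T]; L²(ℝ²))} ). -/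

import Mathlib

open MeasureTheory Complex SchwartzMap
open scoped ENNReal NNReal Real

noncomputable section

/-- 1D Fourier transform with the convention `f̂ ξ = ∫ e^{-iξx} f x dx`. -/
def FT1 (f : ℝ → ℂ) (ξ : ℝ) : ℂ :=
  ∫ x : ℝ, Complex.exp (-(Complex.I) * (ξ : ℂ) * (x : ℂ)) * f x

/-- 1D inverse Fourier transform. -/
def IFT1 (g : ℝ → ℂ) (x : ℝ) : ℂ :=
  (2 * (Real.pi : ℂ))⁻¹ * ∫ ξ : ℝ, Complex.exp (Complex.I * (ξ : ℂ) * (x : ℂ)) * g ξ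

/-- 2D Fourier transform (curried kernels). -/
def FT2 (f : ℝ → ℝ → ℂ) (ξ η : ℝ) : ℂ :=
  ∫ x : ℝ, ∫ y : ℝ, Complex.exp (-(Complex.I) * ((ξ : ℂ) * x + (η : ℂ) * y)) * f x y

/-- 2D inverse Fourier transform. -/
def IFT2 (g : ℝ → ℝ → ℂ) (x y : ℝ) : ℂ :=
  ((2 * (Real.pi : ℂ)) ^ 2)⁻¹ *
    ∫ ξ : ℝ, ∫ η : ℝ, Complex.exp (Complex.I * ((ξ : ℂ) * x + (η : ℂ) * y)) * g ξ η

/-- Free propagator `e^{it(Δ_x − Δ_y)}`, Fourier multiplier `e^{it(η²−ξ²)}`. -/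
def freeGamma (Γ₀ : ℝ → ℝ → ℂ) (t x y : ℝ) : ℂ :=
  IFT2 (fun ξ η => Complex.exp (Complex.I * (t : ℂ) * ((η : ℂ) ^ 2 - (ξ : ℂ) ^ 2)) * FT2 Γ₀ ξ η) x y

/-- Free propagator `e^{it(Δ_x + Δ_y)}`, Fourier multiplier `e^{−it(ξ²+η²)}`. -/
def freeLambda (Λ₀ : ℝ → ℝ → ℂ) (t x y : ℝ) : ℂ :=
  IFT2 (fun ξ η => Complex.exp (-(Complex.I) * (t : ℂ) * ((ξ : ℂ) ^ 2 + (η : ℂ) ^ 2)) * FT2 Λ₀ ξ η) x y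

/-- `|∇_x|^s`, Fourier multiplier `|ξ|^s` in one variable. -/
def absDx (s : ℝ) (f : ℝ → ℂ) (x : ℝ) : ℂ :=
  IFT1 (fun ξ => ((|ξ| ^ s : ℝ) : ℂ) * FT1 f ξ) x

/-- `|∇_{x,y}|^s`, Fourier multiplier `(ξ²+η²)^{s/2}` on `ℝ²`. -/
def absDxy (s : ℝ) (f : ℝ → ℝ → ℂ) (x y : ℝ) : ℂ :=
  IFT2 (fun ξ η => (((ξ ^ 2 + η ^ 2) ^ (s / 2) : ℝ) : ℂ) * FT2 f ξ η) x y

/-- `|∇_{x+y}|^s`, Fourier multiplier `(|ξ+η|/2)^s` on `ℝ²`. -/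
def absDxpy (s : ℝ) (f : ℝ → ℝ → ℂ) (x y : ℝ) : ℂ :=
  IFT2 (fun ξ η => (((|ξ + η| / 2) ^ s : ℝ) : ℂ) * FT2 f ξ η) x y

/-- `⟨∇_x⟩^s`, Fourier multiplier `(1+ξ²)^{s/2}` in one variable. -/
def japDx (s : ℝ) (f : ℝ → ℂ) (x : ℝ) : ℂ :=
  IFT1 (fun ξ => (((1 + ξ ^ 2) ^ (s / 2) : ℝ) : ℂ) * FT1 f ξ) x

/-- `⟨∇_{x,y}⟩^s`, Fourier multiplier `(1+ξ²+η²)^{s/2}` on `ℝ²`. -/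
def japDxy (s : ℝ) (f : ℝ → ℝ → ℂ) (x y : ℝ) : ℂ :=
  IFT2 (fun ξ η => (((1 + ξ ^ 2 + η ^ 2) ^ (s / 2) : ℝ) : ℂ) * FT2 f ξ η) x y

/-- `L²` norm of a kernel on `ℝ²`. -/
def L2K (f : ℝ → ℝ → ℂ) : ℝ≥0∞ :=
  eLpNorm (fun p : ℝ × ℝ => f p.1 p.2) 2 volume

/-- `L²` norm on `ℝ`. -/
def L2F (f : ℝ → ℂ) : ℝ≥0∞ := eLpNorm f 2 volume

/-- Mixed norm `L^q(μ(dt)) L^r(dx)` for a function of `(t,x)`. -/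
def MixedN2 (μ : Measure ℝ) (q r : ℝ≥0∞) (u : ℝ → ℝ → ℂ) : ℝ≥0∞ :=
  eLpNorm (fun t => (eLpNorm (u t) r volume).toReal) q μ

/-- Mixed norm `L^q(μ(dt)) L^r(dx) L^s(dy)` for a function of `(t,x,y)`. -/
def MixedN3 (μ : Measure ℝ) (q r s : ℝ≥0∞) (u : ℝ → ℝ → ℝ → ℂ) : ℝ≥0∞ :=
  eLpNorm (fun t => (eLpNorm (fun x => (eLpNorm (u t x) s volume).toReal) r volume).toReal) q μ

/-- Spacetime Fourier transform on `ℝ_t × ℝ_x`. -/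
def FTtx (u : ℝ → ℝ → ℂ) (τ ξ : ℝ) : ℂ :=
  ∫ t : ℝ, ∫ x : ℝ, Complex.exp (-(Complex.I) * ((τ : ℂ) * t + (ξ : ℂ) * x)) * u t x

/-- Spacetime Fourier transform on `ℝ_t × ℝ²`. -/
def FTtxy (u : ℝ → ℝ → ℝ → ℂ) (τ ξ η : ℝ) : ℂ :=
  ∫ t : ℝ, ∫ x : ℝ, ∫ y : ℝ,
    Complex.exp (-(Complex.I) * ((τ : ℂ) * t + (ξ : ℂ) * x + (η : ℂ) * y)) * u t x y

/-- Bourgain space norm `X^b` associated to `𝐒 = (1/i)∂_t − Δ_x − Δ_y`. -/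
def XbNorm (b : ℝ) (u : ℝ → ℝ → ℝ → ℂ) : ℝ≥0∞ :=
  eLpNorm (fun p : ℝ × ℝ × ℝ =>
    (((1 + |p.1 + p.2.1 ^ 2 + p.2.2 ^ 2|) ^ b : ℝ) : ℂ) * FTtxy u p.1 p.2.1 p.2.2) 2 volume

/-- Duhamel solution of `𝐒_± Γ = F` with data `Γ₀`. -/
def duhamelGamma (Γ₀ : ℝ → ℝ → ℂ) (F : ℝ → ℝ → ℝ → ℂ) (t x y : ℝ) : ℂ :=
  freeGamma Γ₀ t x y + Complex.I * ∫ s in (0:ℝ)..t, freeGamma (F s) (t - s) x y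

/-- Duhamel solution of `𝐒 Λ = F` with data `Λ₀`. -/
def duhamelLambda (Λ₀ : ℝ → ℝ → ℂ) (F : ℝ → ℝ → ℝ → ℂ) (t x y : ℝ) : ℂ :=
  freeLambda Λ₀ t x y + Complex.I * ∫ s in (0:ℝ)..t, freeLambda (F s) (t - s) x y

open scoped FourierTransform ContDiff

section Plancherel

variable {V : Type*} [NormedAddCommGroup V] [InnerProductSpace ℝ V] [FiniteDimensional ℝ V]
  [MeasurableSpace V] [BorelSpace V]

/-- On `L¹ ∩ L²` the `L²` Fourier transform is given by the Fourier integral. -/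
theorem fourier_toLp_ae_eq {f : V → ℂ} (h1 : Integrable f) (h2 : MemLp f 2) :
    (𝓕 (h2.toLp f) : Lp ℂ 2 (volume : Measure V)) =ᵐ[volume] 𝓕 f := by
  apply ae_eq_of_integral_contDiff_smul_eq
  · exact (Lp.memLp _).locallyIntegrable (by norm_num)
  · exact (VectorFourier.fourierIntegral_continuous Real.continuous_fourierChar
      continuous_inner h1).locallyIntegrable
  · intro g g_smooth g_cpt
    have hg₁ : HasCompactSupport (Complex.ofRealCLM ∘ g) := g_cpt.comp_left rfl
    have hg₂ : ContDiff ℝ ∞ (Complex.ofRealCLM ∘ g) := by fun_prop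
    set φ : 𝓢(V, ℂ) := hg₁.toSchwartzMap hg₂ with hφ
    have hφ' : ∀ x, φ x = (g x : ℂ) := fun x => rfl
    have e1 := DFunLike.congr_fun (Lp.fourier_toTemperedDistribution_eq (h2.toLp f)) φ
    rw [TemperedDistribution.fourier_apply, Lp.toTemperedDistribution_apply,
      Lp.toTemperedDistribution_apply] at e1
    have e2 : ∫ x, g x • (𝓕 (h2.toLp f) : Lp ℂ 2 (volume : Measure V)) x =
        ∫ x, φ x • (𝓕 (h2.toLp f) : Lp ℂ 2 (volume : Measure V)) x := by
      simp [hφ']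
    have e3 : ∫ x, g x • 𝓕 f x = ∫ x, φ x • 𝓕 f x := by simp [hφ']
    rw [e2, e3, ← e1]
    have e4 : ∫ x, (𝓕 φ) x • (h2.toLp f) x = ∫ x, (𝓕 φ) x • f x := by
      apply integral_congr_ae
      filter_upwards [h2.coeFn_toLp] with x hx
      rw [hx]
    rw [e4]
    have := VectorFourier.integral_fourierIntegral_smul_eq_flip (μ := (volume : Measure V))
      (ν := (volume : Measure V)) (L := innerₗ V)
      Real.continuous_fourierChar continuous_inner (φ.integrable (μ := volume)) h1
    simpa [flip_innerₗ, SchwartzMap.fourier_coe, Real.fourier_eq, VectorFourier.fourierIntegral]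
      using this

theorem eLpNorm_fourier_eq {f : V → ℂ} (h1 : Integrable f) (h2 : MemLp f 2) :
    eLpNorm (𝓕 f) 2 volume = eLpNorm f 2 volume := by
  rw [← eLpNorm_congr_ae (fourier_toLp_ae_eq h1 h2), ← eLpNorm_congr_ae h2.coeFn_toLp,
    ← Lp.enorm_def, ← Lp.enorm_def]
  simp only [← ofReal_norm, Lp.norm_fourier_eq]

theorem lintegral_enorm_sq_eq_eLpNorm_sq {α E : Type*} [MeasurableSpace α] [NormedAddCommGroup E]
    (μ : Measure α) (f : α → E) : ∫⁻ x, ‖f x‖ₑ ^ 2 ∂μ = eLpNorm f 2 μ ^ 2 := by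
  rw [eLpNorm_eq_lintegral_rpow_enorm_toReal (by norm_num) (by norm_num)]
  rw [← ENNReal.rpow_natCast, ← ENNReal.rpow_mul]
  simp

theorem lintegral_enorm_sq_fourier_eq {f : V → ℂ} (h1 : Integrable f) (h2 : MemLp f 2) :
    ∫⁻ x, ‖𝓕 f x‖ₑ ^ 2 = ∫⁻ x, ‖f x‖ₑ ^ 2 := by
  rw [lintegral_enorm_sq_eq_eLpNorm_sq, lintegral_enorm_sq_eq_eLpNorm_sq, eLpNorm_fourier_eq h1 h2]

theorem lintegral_enorm_sq_fourierInv_eq {f : V → ℂ} (h1 : Integrable f) (h2 : MemLp f 2) :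
    ∫⁻ x, ‖𝓕⁻ f x‖ₑ ^ 2 = ∫⁻ x, ‖f x‖ₑ ^ 2 := by
  rw [← lintegral_enorm_sq_fourier_eq h1 h2, ← lintegral_neg_eq_self]
  simp [Real.fourierInv_eq_fourier_neg]

end Plancherel

theorem lintegral_comp_smul_haar {V : Type*} [NormedAddCommGroup V] [NormedSpace ℝ V]
    [FiniteDimensional ℝ V] [MeasurableSpace V] [BorelSpace V] (μ : Measure V) [μ.IsAddHaarMeasure]
    (f : V → ℝ≥0∞) {r : ℝ} (hr : r ≠ 0) :
    ∫⁻ x, f (r • x) ∂μ = ENNReal.ofReal |(r ^ Module.finrank ℝ V)⁻¹| * ∫⁻ x, f x ∂μ := by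
  have := (Homeomorph.smulOfNeZero (α := V) r hr).measurableEmbedding
  rw [← smul_eq_mul, ← lintegral_smul_measure, ← Measure.map_addHaar_smul μ hr]
  exact (this.lintegral_map f).symm

theorem FT1_eq (f : ℝ → ℂ) (ξ : ℝ) : FT1 f ξ = 𝓕 f (ξ / (2 * π)) := by
  rw [FT1, Real.fourier_real_eq_integral_exp_smul]
  congr 1; ext x
  rw [smul_eq_mul]
  congr 2
  push_cast
  field_simp

theorem IFT1_eq (g : ℝ → ℂ) (x : ℝ) : IFT1 g x = (2 * (π : ℂ))⁻¹ * 𝓕⁻ g (x / (2 * π)) := by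
  rw [IFT1, Real.fourierInv_eq', ]
  congr 2; ext y
  rw [smul_eq_mul]
  congr 2
  simp
  field_simp

theorem FT1_IFT1 {g : ℝ → ℂ} (hc : Continuous g) (hg : Integrable g) (hi : Integrable (IFT1 g)) :
    FT1 (IFT1 g) = g := by
  have hpi : (2 * π) ≠ 0 := by positivity
  have h1 : Integrable (𝓕⁻ g) := by
    have := (hi.comp_mul_left' hpi).const_mul (2 * (π : ℂ))
    refine this.congr (Filter.Eventually.of_forall fun x => ?_)
    simp only [IFT1_eq]
    field_simp
  have h2 : Integrable (𝓕 g) := by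
    have := h1.comp_neg
    simpa [Real.fourierInv_eq_fourier_neg] using this
  have h3 := hc.fourier_fourierInv_eq hg h2
  ext ξ
  rw [← congrFun h3 ξ, FT1_eq, Real.fourier_real_eq_integral_exp_smul,
    Real.fourier_real_eq_integral_exp_smul]
  have := Measure.integral_comp_mul_left
    (fun v : ℝ => cexp (↑(-2 * π * v * (ξ / (2 * π))) * I) • IFT1 g v) (2 * π)
  rw [abs_of_pos (by positivity)] at this
  have h4 : (∫ v : ℝ, cexp (↑(-2 * π * v * (ξ / (2 * π))) * I) • IFT1 g v) =
     (2 * π) • ((2 * π)⁻¹ • (∫ v : ℝ, cexp (↑(-2 * π * v * (ξ / (2 * π))) * I) • IFT1 g v)) := by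
    rw [smul_smul, mul_inv_cancel₀ hpi, one_smul]
  rw [h4, ← this, ← integral_smul]
  congr 1; ext v
  rw [IFT1_eq]
  simp only [smul_eq_mul, real_smul]
  have : 2 * π * v / (2 * π) = v := by field_simp
  rw [this]
  have : -2 * π * (2 * π * v) * (ξ / (2 * π)) = -2 * π * v * ξ := by field_simp
  rw [this]
  push_cast
  field_simp

theorem lintegral_enorm_sq_IFT1 {g : ℝ → ℂ} (h1 : Integrable g) (h2 : MemLp g 2) :
    ∫⁻ x, ‖IFT1 g x‖ₑ ^ 2 = ENNReal.ofReal (2 * π)⁻¹ * ∫⁻ x, ‖g x‖ₑ ^ 2 := by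
  have e : ∀ x, ‖IFT1 g x‖ₑ ^ 2 = ENNReal.ofReal ((2 * π)⁻¹ ^ 2) * ‖𝓕⁻ g ((2 * π)⁻¹ • x)‖ₑ ^ 2 := by
    intro x
    rw [IFT1_eq, enorm_mul, mul_pow, ENNReal.ofReal_pow (by positivity)]
    congr 2
    · rw [← ofReal_norm]; simp [abs_of_pos Real.pi_pos]
    · simp [div_eq_inv_mul]
  simp_rw [e]
  rw [lintegral_const_mul' _ _ (by simp), lintegral_comp_smul_haar _ (fun x => ‖𝓕⁻ g x‖ₑ ^ 2)
    (by positivity), lintegral_enorm_sq_fourierInv_eq h1 h2, ← mul_assoc,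
    ← ENNReal.ofReal_mul (by positivity)]
  congr 2
  rw [abs_of_pos (by positivity)]
  simp
  field_simp

/-- Kernels on `ℝ × ℝ` as functions on the Euclidean plane. -/
def euclLift (f : ℝ → ℝ → ℂ) (v : WithLp 2 (ℝ × ℝ)) : ℂ := f v.ofLp.1 v.ofLp.2

theorem integrable_euclLift {f : ℝ → ℝ → ℂ} :
    Integrable (euclLift f) ↔ Integrable (fun p : ℝ × ℝ => f p.1 p.2) :=
  (WithLp.volume_preserving_ofLp (U := ℝ) (V := ℝ)).integrable_comp_emb
    (MeasurableEquiv.toLp 2 (ℝ × ℝ)).symm.measurableEmbedding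
    (g := fun p : ℝ × ℝ => f p.1 p.2)

theorem lintegral_eucl (f : ℝ → ℝ → ℝ≥0∞) :
    ∫⁻ v : WithLp 2 (ℝ × ℝ), f v.ofLp.1 v.ofLp.2 = ∫⁻ p : ℝ × ℝ, f p.1 p.2 :=
  (WithLp.volume_preserving_ofLp (U := ℝ) (V := ℝ)).lintegral_comp_emb
    (MeasurableEquiv.toLp 2 (ℝ × ℝ)).symm.measurableEmbedding
    (fun p : ℝ × ℝ => f p.1 p.2)

theorem integral_eucl (f : ℝ → ℝ → ℂ) :
    ∫ v : WithLp 2 (ℝ × ℝ), f v.ofLp.1 v.ofLp.2 = ∫ p : ℝ × ℝ, f p.1 p.2 :=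
  (WithLp.volume_preserving_ofLp (U := ℝ) (V := ℝ)).integral_comp
    (MeasurableEquiv.toLp 2 (ℝ × ℝ)).symm.measurableEmbedding
    (fun p : ℝ × ℝ => f p.1 p.2)

theorem enorm_exp_I_mul (θ : ℝ) : ‖cexp (I * (θ : ℂ))‖ₑ = 1 := by
  rw [← ofReal_norm, mul_comm, Complex.norm_exp_ofReal_mul_I]; simp

theorem integrable_phase_mul {α : Type*} [TopologicalSpace α] [MeasurableSpace α]
    [OpensMeasurableSpace α] {μ : Measure α}
    {f : α → ℂ} (hf : Integrable f μ) {θ : α → ℝ} (hθ : Continuous θ) :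
    Integrable (fun a => cexp (I * (θ a : ℂ)) * f a) μ := by
  refine hf.bdd_mul (c := 1) (Continuous.aestronglyMeasurable (by fun_prop)) ?_
  refine Filter.Eventually.of_forall fun a => ?_
  rw [mul_comm, Complex.norm_exp_ofReal_mul_I]

theorem FT2_eq_integral_prod {f : ℝ → ℝ → ℂ} (hf : Integrable (fun p : ℝ × ℝ => f p.1 p.2))
    (ξ η : ℝ) :
    FT2 f ξ η = ∫ p : ℝ × ℝ, cexp (I * ((-(ξ * p.1 + η * p.2) : ℝ) : ℂ)) * f p.1 p.2 := by
  rw [Measure.volume_eq_prod, integral_prod, FT2]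
  · congr 1; ext x; congr 1; ext y; congr 2; push_cast; ring
  · exact integrable_phase_mul hf (by fun_prop)

theorem IFT2_eq_integral_prod {g : ℝ → ℝ → ℂ} (hg : Integrable (fun p : ℝ × ℝ => g p.1 p.2))
    (x y : ℝ) :
    IFT2 g x y = ((2 * (π : ℂ)) ^ 2)⁻¹ *
      ∫ p : ℝ × ℝ, cexp (I * ((p.1 * x + p.2 * y : ℝ) : ℂ)) * g p.1 p.2 := by
  rw [Measure.volume_eq_prod, integral_prod, IFT2]
  · congr 2; ext x; congr 1; ext y; congr 2; push_cast; ring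
  · exact integrable_phase_mul hg (by fun_prop)

theorem FT2_eq {f : ℝ → ℝ → ℂ} (hf : Integrable (fun p : ℝ × ℝ => f p.1 p.2)) (ξ η : ℝ) :
    FT2 f ξ η = 𝓕 (euclLift f) ((2 * π)⁻¹ • WithLp.toLp 2 (ξ, η)) := by
  rw [FT2_eq_integral_prod hf, Real.fourier_eq', ← integral_eucl
    (fun a b => cexp (I * ((-(ξ * a + η * b) : ℝ) : ℂ)) * f a b)]
  congr 1; ext v
  rw [smul_eq_mul, euclLift]
  congr 2
  simp [inner_smul_right, WithLp.prod_inner_apply]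
  field_simp
  ring

theorem IFT2_eq {g : ℝ → ℝ → ℂ} (hg : Integrable (fun p : ℝ × ℝ => g p.1 p.2)) (x y : ℝ) :
    IFT2 g x y = ((2 * (π : ℂ)) ^ 2)⁻¹ * 𝓕⁻ (euclLift g) ((2 * π)⁻¹ • WithLp.toLp 2 (x, y)) := by
  rw [IFT2_eq_integral_prod hg, Real.fourierInv_eq', ← integral_eucl
    (fun a b => cexp (I * ((a * x + b * y : ℝ) : ℂ)) * g a b)]
  congr 2; ext v
  rw [smul_eq_mul, euclLift]
  congr 2
  simp [inner_smul_right, WithLp.prod_inner_apply]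
  field_simp

theorem lintegral_enorm_sq_IFT2 {g : ℝ → ℝ → ℂ} (h1 : Integrable (fun p : ℝ × ℝ => g p.1 p.2))
    (h2 : MemLp (fun p : ℝ × ℝ => g p.1 p.2) 2) :
    ∫⁻ p : ℝ × ℝ, ‖IFT2 g p.1 p.2‖ₑ ^ 2 =
      ENNReal.ofReal ((2 * π) ^ 2)⁻¹ * ∫⁻ p : ℝ × ℝ, ‖g p.1 p.2‖ₑ ^ 2 := by
  have h1' := integrable_euclLift.2 h1
  have h2' : MemLp (euclLift g) 2 :=
    h2.comp_measurePreserving (WithLp.volume_preserving_ofLp (U := ℝ) (V := ℝ))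
  have e : ∀ v : WithLp 2 (ℝ × ℝ), ‖IFT2 g v.ofLp.1 v.ofLp.2‖ₑ ^ 2 =
      ENNReal.ofReal (((2 * π)^2)⁻¹ ^ 2) * ‖𝓕⁻ (euclLift g) ((2 * π)⁻¹ • v)‖ₑ ^ 2 := by
    intro x
    rw [IFT2_eq h1, enorm_mul, mul_pow, ENNReal.ofReal_pow (by positivity)]
    congr 2
    · rw [← ofReal_norm]; simp [abs_of_pos Real.pi_pos]
  rw [← lintegral_eucl (fun a b => ‖IFT2 g a b‖ₑ ^ 2), ← lintegral_eucl (fun a b => ‖g a b‖ₑ ^ 2)]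
  simp_rw [e]
  rw [lintegral_const_mul' _ _ (by simp), lintegral_comp_smul_haar _
    (fun x => ‖𝓕⁻ (euclLift g) x‖ₑ ^ 2)
    (by positivity), lintegral_enorm_sq_fourierInv_eq h1' h2', ← mul_assoc,
    ← ENNReal.ofReal_mul (by positivity)]
  congr 2
  have : Module.finrank ℝ (WithLp 2 (ℝ × ℝ)) = 2 := by
    rw [(WithLp.linearEquiv 2 ℝ (ℝ × ℝ)).finrank_eq]; simp
  rw [abs_of_pos (by positivity), this]
  field_simp

theorem FT2_IFT2 {g : ℝ → ℝ → ℂ} (hc : Continuous (fun p : ℝ × ℝ => g p.1 p.2))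
    (hg : Integrable (fun p : ℝ × ℝ => g p.1 p.2))
    (hi : Integrable (fun p : ℝ × ℝ => IFT2 g p.1 p.2)) :
    FT2 (IFT2 g) = g := by
  have hpi : (2 * π) ≠ 0 := by positivity
  have hi' := integrable_euclLift.2 hi
  have key : ∀ v, 𝓕⁻ (euclLift g) v = (2 * (π : ℂ)) ^ 2 * euclLift (IFT2 g) ((2 * π) • v) := by
    intro v
    rw [euclLift, IFT2_eq hg]
    rw [show WithLp.toLp 2 (((2 * π) • v).ofLp.1, ((2 * π) • v).ofLp.2) = (2 * π) • v from rfl,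
      smul_smul, inv_mul_cancel₀ hpi, one_smul]
    field_simp
  have h1 : Integrable (𝓕⁻ (euclLift g)) := by
    have := (hi'.comp_smul hpi).const_mul ((2 * (π : ℂ)) ^ 2)
    exact this.congr (Filter.Eventually.of_forall fun x => (key x).symm)
  have h2 : Integrable (𝓕 (euclLift g)) := by
    have := h1.comp_neg
    simpa [Real.fourierInv_eq_fourier_neg] using this
  have hc' : Continuous (euclLift g) := hc.comp (WithLp.prod_continuous_ofLp 2 ℝ ℝ)
  have h3 := hc'.fourier_fourierInv_eq (integrable_euclLift.2 hg) h2
  have : Module.finrank ℝ (WithLp 2 (ℝ × ℝ)) = 2 := by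
    rw [(WithLp.linearEquiv 2 ℝ (ℝ × ℝ)).finrank_eq]; simp
  ext ξ η
  have e0 := Measure.integral_comp_smul (volume : Measure (WithLp 2 (ℝ × ℝ)))
    (fun v => cexp (↑(-2 * π * inner ℝ v ((2 * π)⁻¹ • WithLp.toLp 2 (ξ, η))) * I) •
      euclLift (IFT2 g) v) (2 * π)
  rw [this, abs_of_pos (by positivity)] at e0
  have h5 : g ξ η = 𝓕 (𝓕⁻ (euclLift g)) (WithLp.toLp 2 (ξ, η)) := by rw [h3]; rfl
  rw [h5, FT2_eq hi, Real.fourier_eq', Real.fourier_eq']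
  rw [← one_smul ℝ (∫ v, cexp (↑(-2 * π * inner ℝ v ((2 * π)⁻¹ • WithLp.toLp 2 (ξ, η))) * I) •
      euclLift (IFT2 g) v), ← mul_inv_cancel₀ (pow_ne_zero 2 hpi), mul_smul, ← e0, ← integral_smul]
  congr 1; ext v
  rw [key]
  simp only [smul_eq_mul, real_smul, inner_smul_left, inner_smul_right]
  rw [show -2 * π * ((2 * π)⁻¹ * ((starRingEnd ℝ) (2 * π) * inner ℝ v (WithLp.toLp 2 (ξ, η)))) =
    -2 * π * inner ℝ v (WithLp.toLp 2 (ξ, η)) by simp; field_simp]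
  push_cast
  ring

section Family

variable {ι : Type*} {E : Type*} [NormedAddCommGroup E] [NormedSpace ℝ E]
  {D : Type*} [NormedAddCommGroup D] [NormedSpace ℝ D]

/-- A family of Schwartz functions that is bounded for every Schwartz seminorm. -/
def SchwartzBdd (f : ι → 𝓢(E, ℂ)) : Prop :=
  ∀ k n : ℕ, ∃ C : ℝ, ∀ i, SchwartzMap.seminorm ℂ k n (f i) ≤ C

theorem SchwartzBdd.exists_sup_le {f : ι → 𝓢(E, ℂ)} (hf : SchwartzBdd f) (s : Finset (ℕ × ℕ)) :
    ∃ C : ℝ, 0 ≤ C ∧ ∀ i, s.sup (schwartzSeminormFamily ℂ E ℂ) (f i) ≤ C := by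
  choose C hC using hf
  refine ⟨∑ j ∈ s, |C j.1 j.2|, by positivity, fun i => ?_⟩
  refine Seminorm.finset_sup_apply_le (by positivity) fun j hj => ?_
  exact ((hC j.1 j.2 i).trans (le_abs_self _)).trans
    (Finset.single_le_sum (f := fun j : ℕ × ℕ => |C j.1 j.2|) (fun _ _ => abs_nonneg _) hj)

theorem SchwartzBdd.map {f : ι → 𝓢(E, ℂ)} (hf : SchwartzBdd f) (A : 𝓢(E, ℂ) →L[ℂ] 𝓢(D, ℂ)) :
    SchwartzBdd fun i => A (f i) := by
  intro k n
  obtain ⟨s, C, -, hC⟩ := Seminorm.bound_of_continuous (schwartz_withSeminorms ℂ E ℂ)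
    ((schwartzSeminormFamily ℂ D ℂ (k, n)).comp A.toLinearMap)
    (((schwartz_withSeminorms ℂ D ℂ).continuous_seminorm (k, n)).comp A.continuous)
  obtain ⟨M, hM0, hM⟩ := hf.exists_sup_le s
  exact ⟨C * M, fun i => (hC (f i)).trans (mul_le_mul_of_nonneg_left (hM i) C.2)⟩

theorem SchwartzBdd.exists_decay {f : ι → 𝓢(E, ℂ)} (hf : SchwartzBdd f) (k n : ℕ) :
    ∃ C : ℝ, 0 ≤ C ∧ ∀ i x, ∀ N ≤ n, (1 + ‖x‖) ^ k * ‖iteratedFDeriv ℝ N (f i) x‖ ≤ C := by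
  obtain ⟨M, hM0, hM⟩ := hf.exists_sup_le (Finset.Iic (k, n))
  refine ⟨2 ^ k * M, by positivity, fun i x N hN => ?_⟩
  exact (one_add_le_sup_seminorm_apply (𝕜 := ℂ) (m := (k, n)) le_rfl hN (f i) x).trans
    (mul_le_mul_of_nonneg_left (hM i) (by positivity))

theorem SchwartzBdd.smulLeft {f : ι → 𝓢(E, ℂ)} (hf : SchwartzBdd f) {m : ι → E → ℂ}
    (hm : ∀ i, (m i).HasTemperateGrowth)
    (hb : ∀ n : ℕ, ∃ (l : ℕ) (C : ℝ), 0 ≤ C ∧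
      ∀ i, ∀ N ≤ n, ∀ x, ‖iteratedFDeriv ℝ N (m i) x‖ ≤ C * (1 + ‖x‖) ^ l) :
    SchwartzBdd fun i => smulLeftCLM ℂ (m i) (f i) := by
  intro k n
  obtain ⟨l, C, hC0, hC⟩ := hb n
  obtain ⟨M, hM0, hM⟩ := hf.exists_decay (k + l) n
  refine ⟨∑ j ∈ Finset.range (n + 1), n.choose j * (C * M), fun i => ?_⟩
  refine SchwartzMap.seminorm_le_bound ℂ k n _ (by positivity) fun x => ?_
  rw [smulLeftCLM_apply (hm i)]
  have h := norm_iteratedFDeriv_smul_le (hm i).1 ((f i).smooth ⊤) x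
    (n := n) (mod_cast le_top)
  refine (mul_le_mul_of_nonneg_left h (by positivity)).trans ?_
  rw [Finset.mul_sum]
  refine Finset.sum_le_sum fun j hj => ?_
  rw [Finset.mem_range_succ_iff] at hj
  have h1 := hC i j hj x
  have h2 := hM i x (n - j) (Nat.sub_le _ _)
  calc ‖x‖ ^ k * (n.choose j * ‖iteratedFDeriv ℝ j (m i) x‖ * ‖iteratedFDeriv ℝ (n - j) (f i) x‖)
      ≤ (1 + ‖x‖) ^ k * (n.choose j * (C * (1 + ‖x‖) ^ l) *
          ‖iteratedFDeriv ℝ (n - j) (f i) x‖) := by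
        gcongr
        linarith
    _ = n.choose j * (C * ((1 + ‖x‖) ^ (k + l) * ‖iteratedFDeriv ℝ (n - j) (f i) x‖)) := by ring
    _ ≤ n.choose j * (C * M) := by gcongr

theorem norm_iteratedFDeriv_slice_le {f : D × E → ℂ} (hf : ContDiff ℝ ∞ f) (n : ℕ) (s : D) (x : E) :
    ‖iteratedFDeriv ℝ n (fun y => f (s, y)) x‖ ≤ ‖iteratedFDeriv ℝ n f (s, x)‖ := by
  have h : (fun y => f (s, y)) = (fun q => f ((s, 0) + q)) ∘ ContinuousLinearMap.inr ℝ D E := by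
    ext y; simp
  have hc : ContDiff ℝ ∞ fun q : D × E => f ((s, 0) + q) := by fun_prop
  rw [h, ContinuousLinearMap.iteratedFDeriv_comp_right _ hc _ (mod_cast le_top),
    iteratedFDeriv_comp_add_left]
  refine (ContinuousMultilinearMap.norm_compContinuousLinearMap_le _ _).trans ?_
  simp only [ContinuousLinearMap.inr_apply, Prod.mk_add_mk, add_zero, zero_add, Finset.prod_const,
    Finset.card_univ, Fintype.card_fin]
  exact mul_le_of_le_one_right (norm_nonneg _)
    (pow_le_one₀ (norm_nonneg _) (ContinuousLinearMap.norm_inr_le_one ℝ D E))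

theorem hasTemperateGrowth_prodMk_left (s : D) :
    Function.HasTemperateGrowth (fun y : E => (s, y)) := by
  have : (fun y : E => (s, y)) = fun y => (s, (0 : E)) + ContinuousLinearMap.inr ℝ D E y := by
    ext y <;> simp
  rw [this]
  fun_prop

/-- The slice `y ↦ F (s, y)` of a Schwartz function. -/
noncomputable def schwartzSlice (s : D) : 𝓢(D × E, ℂ) →L[ℂ] 𝓢(E, ℂ) :=
  compCLM ℂ (hasTemperateGrowth_prodMk_left s) ⟨1, 1, fun x => by
    simp only [pow_one, one_mul]
    have := norm_snd_le ((s, x) : D × E)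
    simp only at this
    linarith⟩

theorem schwartzSlice_apply (s : D) (F : 𝓢(D × E, ℂ)) (y : E) :
    schwartzSlice s F y = F (s, y) := rfl

theorem schwartzBdd_slice (F : 𝓢(D × E, ℂ)) : SchwartzBdd fun s : D => schwartzSlice s F := by
  intro k n
  refine ⟨SchwartzMap.seminorm ℂ k n F, fun s => ?_⟩
  refine SchwartzMap.seminorm_le_bound ℂ k n _ (by positivity) fun x => ?_
  refine le_trans ?_ (SchwartzMap.le_seminorm ℂ k n F (s, x))
  gcongr
  · exact norm_snd_le (s, x)
  · exact norm_iteratedFDeriv_slice_le (F.smooth ⊤) n s x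

theorem hasTemperateGrowth_cexp_I :
    Function.HasTemperateGrowth fun x : ℝ => cexp (I * (x : ℂ)) := by
  have hd : ∀ n : ℕ, iteratedDeriv n (fun x : ℝ => cexp (I * (x : ℂ))) =
      fun x : ℝ => I ^ n * cexp (I * (x : ℂ)) := by
    intro n
    induction n with
    | zero => simp
    | succ n ih =>
      rw [iteratedDeriv_succ, ih]
      ext x
      have h : HasDerivAt (fun x : ℝ => cexp (I * (x : ℂ))) (cexp (I * (x : ℂ)) * (I * 1)) x :=
        ((hasDerivAt_id x).ofReal_comp.const_mul I).cexp
      rw [(h.const_mul (I ^ n)).deriv]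
      ring
  refine ⟨((contDiff_const.mul Complex.ofRealCLM.contDiff).cexp), fun n => ⟨0, 1, fun x => ?_⟩⟩
  rw [norm_iteratedFDeriv_eq_norm_iteratedDeriv, hd]
  simp [mul_comm I, Complex.norm_exp_ofReal_mul_I]

theorem hasTemperateGrowth_phase : Function.HasTemperateGrowth
    fun q : ℝ × ℝ × ℝ => cexp (I * ((q.1 * (q.2.2 ^ 2 - q.2.1 ^ 2) : ℝ) : ℂ)) := by
  have h1 : Function.HasTemperateGrowth fun q : ℝ × ℝ × ℝ => q.1 :=
    (ContinuousLinearMap.fst ℝ ℝ (ℝ × ℝ)).hasTemperateGrowth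
  have h2 : Function.HasTemperateGrowth fun q : ℝ × ℝ × ℝ => q.2.1 :=
    (ContinuousLinearMap.fst ℝ ℝ ℝ ∘L ContinuousLinearMap.snd ℝ ℝ (ℝ × ℝ)).hasTemperateGrowth
  have h3 : Function.HasTemperateGrowth fun q : ℝ × ℝ × ℝ => q.2.2 :=
    (ContinuousLinearMap.snd ℝ ℝ ℝ ∘L ContinuousLinearMap.snd ℝ ℝ (ℝ × ℝ)).hasTemperateGrowth
  exact hasTemperateGrowth_cexp_I.comp
    (f := fun q : ℝ × ℝ × ℝ => q.1 * (q.2.2 ^ 2 - q.2.1 ^ 2)) (by fun_prop)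

/-- The Fourier multiplier of the propagator at time `τ`. -/
noncomputable def phaseMul (τ : ℝ) (p : ℝ × ℝ) : ℂ := cexp (I * ((τ * (p.2 ^ 2 - p.1 ^ 2) : ℝ) : ℂ))

theorem hasTemperateGrowth_phaseMul (τ : ℝ) : (phaseMul τ).HasTemperateGrowth :=
  hasTemperateGrowth_phase.comp (hasTemperateGrowth_prodMk_left τ)

theorem SchwartzBdd.smulLeft_phaseMul {f : ι → 𝓢(ℝ × ℝ, ℂ)} (hf : SchwartzBdd f) {τ : ι → ℝ}
    (hτ : ∀ i, |τ i| ≤ 1) : SchwartzBdd fun i => smulLeftCLM ℂ (phaseMul (τ i)) (f i) := by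
  refine hf.smulLeft (fun i => hasTemperateGrowth_phaseMul _) fun n => ?_
  obtain ⟨l, C, hC0, hC⟩ := hasTemperateGrowth_phase.norm_iteratedFDeriv_le_uniform n
  refine ⟨l, C * 2 ^ l, by positivity, fun i N hN x => ?_⟩
  refine (norm_iteratedFDeriv_slice_le hasTemperateGrowth_phase.1 N (τ i) x).trans ?_
  refine (hC N hN _).trans ?_
  rw [mul_assoc, ← mul_pow]
  have : ‖((τ i, x) : ℝ × ℝ × ℝ)‖ ≤ 1 + ‖x‖ := by
    rw [Prod.norm_def]
    refine max_le ?_ (by simp)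
    have := hτ i
    have := norm_nonneg x
    simp only [Real.norm_eq_abs]
    linarith
  gcongr
  linarith [norm_nonneg x]

end Family

/-- `FT2` as a continuous linear map on Schwartz functions. -/
noncomputable def FT2CLM : 𝓢(ℝ × ℝ, ℂ) →L[ℂ] 𝓢(ℝ × ℝ, ℂ) :=
  (compCLMOfContinuousLinearEquiv ℂ ((WithLp.prodContinuousLinearEquiv 2 ℝ ℝ ℝ).symm.trans
    (ContinuousLinearEquiv.smulLeft (Units.mk0 ((2 * π)⁻¹ : ℝ) (by positivity))))) ∘L
  (FourierTransform.fourierCLM ℂ 𝓢(WithLp 2 (ℝ × ℝ), ℂ)) ∘L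
  (compCLMOfContinuousLinearEquiv ℂ (WithLp.prodContinuousLinearEquiv 2 ℝ ℝ ℝ))

/-- `IFT2`, up to a constant factor, as a continuous linear map on Schwartz functions. -/
noncomputable def IFT2CLM : 𝓢(ℝ × ℝ, ℂ) →L[ℂ] 𝓢(ℝ × ℝ, ℂ) :=
  (compCLMOfContinuousLinearEquiv ℂ ((WithLp.prodContinuousLinearEquiv 2 ℝ ℝ ℝ).symm.trans
    (ContinuousLinearEquiv.smulLeft (Units.mk0 ((2 * π)⁻¹ : ℝ) (by positivity))))) ∘L
  (FourierTransform.fourierInvCLM ℂ 𝓢(WithLp 2 (ℝ × ℝ), ℂ)) ∘L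
  (compCLMOfContinuousLinearEquiv ℂ (WithLp.prodContinuousLinearEquiv 2 ℝ ℝ ℝ))

theorem FT2CLM_apply (f : 𝓢(ℝ × ℝ, ℂ)) (p : ℝ × ℝ) :
    FT2CLM f p = FT2 (fun a b => f (a, b)) p.1 p.2 := by
  rw [FT2_eq (f.integrable)]
  rfl

theorem IFT2CLM_apply (f : 𝓢(ℝ × ℝ, ℂ)) (p : ℝ × ℝ) :
    ((2 * (π : ℂ)) ^ 2)⁻¹ * IFT2CLM f p = IFT2 (fun a b => f (a, b)) p.1 p.2 := by
  rw [IFT2_eq (f.integrable)]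
  have : 𝓕⁻ (euclLift fun a b => f (a, b)) =
    𝓕⁻ (compCLMOfContinuousLinearEquiv ℂ (WithLp.prodContinuousLinearEquiv 2 ℝ ℝ ℝ) f) := by
    rw [SchwartzMap.fourierInv_coe]; rfl
  rw [this]
  rfl

theorem SchwartzBdd.exists_bound {ι : Type*} {f : ι → 𝓢(ℝ × ℝ, ℂ)} (hf : SchwartzBdd f) :
    ∃ C : ℝ, 0 ≤ C ∧ ∀ i x y, ‖f i (x, y)‖ ≤ C * (((1 + x ^ 2) ^ 3)⁻¹ * ((1 + y ^ 2) ^ 3)⁻¹) := by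
  obtain ⟨C, hC0, hC⟩ := hf.exists_decay 12 0
  refine ⟨C, hC0, fun i x y => ?_⟩
  have h := hC i (x, y) 0 le_rfl
  rw [norm_iteratedFDeriv_zero] at h
  rw [← mul_inv, ← div_eq_mul_inv, le_div_iff₀ (by positivity), mul_comm]
  refine le_trans ?_ h
  gcongr
  have hx : |x| ≤ ‖((x, y) : ℝ × ℝ)‖ := norm_fst_le ((x, y) : ℝ × ℝ)
  have hy : |y| ≤ ‖((x, y) : ℝ × ℝ)‖ := norm_snd_le ((x, y) : ℝ × ℝ)
  set r := ‖((x, y) : ℝ × ℝ)‖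
  have h1 : ∀ z : ℝ, |z| ≤ r → 1 + z ^ 2 ≤ (1 + r) ^ 2 := by
    intro z hz
    have := abs_nonneg z
    rw [← sq_abs]; nlinarith
  calc (1 + x ^ 2) ^ 3 * (1 + y ^ 2) ^ 3 ≤ ((1 + r) ^ 2) ^ 3 * ((1 + r) ^ 2) ^ 3 := by
        gcongr
        · exact h1 x hx
        · exact h1 y hy
    _ = (1 + r) ^ 12 := by ring

section L2

variable {α β : Type*} [MeasurableSpace α] [MeasurableSpace β]

/-- The `L²` norm of a nonnegative function. -/
noncomputable def l2n (ν : Measure β) (f : β → ℝ≥0∞) : ℝ≥0∞ := (∫⁻ b, f b ^ 2 ∂ν) ^ (1 / 2 : ℝ)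

theorem l2n_sq (ν : Measure β) (f : β → ℝ≥0∞) : l2n ν f ^ 2 = ∫⁻ b, f b ^ 2 ∂ν := by
  rw [l2n, ← ENNReal.rpow_natCast, ← ENNReal.rpow_mul]; simp

theorem l2n_mono {ν : Measure β} {f g : β → ℝ≥0∞} (h : ∀ b, f b ≤ g b) : l2n ν f ≤ l2n ν g := by
  unfold l2n
  gcongr with b
  exact h b

theorem l2n_mono_ae {ν : Measure β} {f g : β → ℝ≥0∞}
    (h : ∀ᵐ b ∂ν, f b ≤ g b) : l2n ν f ≤ l2n ν g := by
  refine ENNReal.rpow_le_rpow (lintegral_mono_ae ?_) (by norm_num)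
  filter_upwards [h] with b hb
  gcongr

theorem l2n_le_iff {ν : Measure β} {f : β → ℝ≥0∞} {c : ℝ≥0∞} :
    l2n ν f ≤ c ↔ ∫⁻ b, f b ^ 2 ∂ν ≤ c ^ 2 := by
  rw [← l2n_sq, ENNReal.pow_le_pow_left_iff (by norm_num)]

theorem l2n_add_le {ν : Measure β} {f g : β → ℝ≥0∞} (hf : AEMeasurable f ν)
    (hg : AEMeasurable g ν) :
    l2n ν (fun b => f b + g b) ≤ l2n ν f + l2n ν g := by
  have := ENNReal.lintegral_Lp_add_le hf hg (p := 2) (by norm_num)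
  simpa [l2n] using this

theorem lintegral_mul_le_l2n {ν : Measure β} {f g : β → ℝ≥0∞} (hf : AEMeasurable f ν)
    (hg : AEMeasurable g ν) : ∫⁻ b, f b * g b ∂ν ≤ l2n ν f * l2n ν g := by
  have := ENNReal.lintegral_mul_le_Lp_mul_Lq ν (p := 2) (q := 2)
    (Real.HolderConjugate.two_two) hf hg
  simpa [l2n] using this

/-- Minkowski's integral inequality in `L²`. -/
theorem l2n_lintegral_le {μ : Measure α} {ν : Measure β} [SFinite μ] [SFinite ν]
    {f : α → β → ℝ≥0∞} (hf : Measurable (Function.uncurry f)) :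
    l2n ν (fun b => ∫⁻ a, f a b ∂μ) ≤ ∫⁻ a, l2n ν (f a) ∂μ := by
  rw [l2n_le_iff]
  have hfa : ∀ a, Measurable (f a) := fun a => hf.comp measurable_prodMk_left
  have hfb : ∀ b, Measurable fun a => f a b := fun b => hf.comp measurable_prodMk_right
  have hn : Measurable fun a => l2n ν (f a) := by
    unfold l2n
    exact (Measurable.lintegral_prod_right' (f := fun p : α × β => f p.1 p.2 ^ 2)
      (hf.pow_const 2)).pow_const _
  calc ∫⁻ b, (∫⁻ a, f a b ∂μ) ^ 2 ∂ν
      = ∫⁻ b, ∫⁻ a, ∫⁻ a', f a b * f a' b ∂μ ∂μ ∂ν := by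
        refine lintegral_congr fun b => ?_
        rw [sq, ← lintegral_mul_const _ (hfb b)]
        refine lintegral_congr fun a => ?_
        rw [lintegral_const_mul _ (hfb b)]
    _ = ∫⁻ a, ∫⁻ b, ∫⁻ a', f a b * f a' b ∂μ ∂ν ∂μ := by
        refine lintegral_lintegral_swap (Measurable.aemeasurable ?_)
        refine Measurable.lintegral_prod_right' (f := fun q : (β × α) × α =>
          f q.1.2 q.1.1 * f q.2 q.1.1) ?_
        exact (hf.comp (measurable_fst.snd.prodMk measurable_fst.fst)).mul
          (hf.comp (measurable_snd.prodMk measurable_fst.fst))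
    _ = ∫⁻ a, ∫⁻ a', ∫⁻ b, f a b * f a' b ∂ν ∂μ ∂μ := by
        refine lintegral_congr fun a => ?_
        refine lintegral_lintegral_swap (Measurable.aemeasurable ?_)
        exact ((hfa a).comp measurable_fst).mul (hf.comp (measurable_snd.prodMk measurable_fst))
    _ ≤ ∫⁻ a, ∫⁻ a', l2n ν (f a) * l2n ν (f a') ∂μ ∂μ := by
        gcongr with a a'
        exact lintegral_mul_le_l2n (hfa a).aemeasurable (hfa a').aemeasurable
    _ = (∫⁻ a, l2n ν (f a) ∂μ) ^ 2 := by
        simp_rw [lintegral_const_mul _ hn]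
        rw [lintegral_mul_const _ hn, sq]

end L2

theorem lintegral_enorm_sq_exp_integral {g : ℝ → ℂ} (h1 : Integrable g) (h2 : MemLp g 2) {ζ : ℝ}
    (hζ : ζ ≠ 0) :
    ∫⁻ τ : ℝ, ‖∫ η : ℝ, cexp (I * ((2 * τ * ζ * η : ℝ) : ℂ)) * g η‖ₑ ^ 2 =
      ENNReal.ofReal (π / |ζ|) * ∫⁻ η, ‖g η‖ₑ ^ 2 := by
  have e : ∀ τ : ℝ, ∫ η : ℝ, cexp (I * ((2 * τ * ζ * η : ℝ) : ℂ)) * g η =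
      𝓕⁻ g ((ζ / π) • τ) := by
    intro τ
    rw [Real.fourierInv_eq']
    congr 1; ext y
    rw [smul_eq_mul]
    congr 2
    simp
    field_simp
  simp_rw [e]
  rw [lintegral_comp_smul_haar _ (fun x => ‖𝓕⁻ g x‖ₑ ^ 2) (by positivity),
    lintegral_enorm_sq_fourierInv_eq h1 h2]
  congr 2
  simp [abs_div, abs_of_pos Real.pi_pos]

theorem lintegral_abs_rpow_neg_Icc {a R : ℝ} (ha : a < 1) (hR : 0 < R) :
    ∫⁻ η in Set.Icc (-R) R, ENNReal.ofReal (|η| ^ (-a)) =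
      ENNReal.ofReal (2 / (1 - a) * R ^ (1 - a)) := by
  have hpos : ∫⁻ η in Set.Ioc 0 R, ENNReal.ofReal (|η| ^ (-a)) =
      ENNReal.ofReal (1 / (1 - a) * R ^ (1 - a)) := by
    have hi : IntegrableOn (fun η : ℝ => |η| ^ (-a)) (Set.Ioc 0 R) := by
      have := (intervalIntegral.intervalIntegrable_rpow' (a := 0) (b := R)
        (show (-1 : ℝ) < -a by linarith)).1
      refine this.congr_fun (fun x hx => ?_) measurableSet_Ioc
      simp [abs_of_pos hx.1]
    rw [← ofReal_integral_eq_lintegral_ofReal hi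
      (Filter.Eventually.of_forall fun x => by positivity)]
    congr 1
    rw [setIntegral_congr_fun (g := fun η : ℝ => η ^ (-a)) measurableSet_Ioc
      (fun x hx => by simp [abs_of_pos hx.1]), ← intervalIntegral.integral_of_le hR.le,
      integral_rpow (Or.inl (by linarith)), Real.zero_rpow (by linarith)]
    rw [show -a + 1 = 1 - a by ring]
    ring
  have hneg : ∫⁻ η in Set.Ico (-R) 0, ENNReal.ofReal (|η| ^ (-a)) =
      ∫⁻ η in Set.Ioc 0 R, ENNReal.ofReal (|η| ^ (-a)) := by
    rw [← lintegral_indicator measurableSet_Ico, ← lintegral_indicator measurableSet_Ioc,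
      ← lintegral_neg_eq_self]
    refine lintegral_congr fun x => ?_
    simp only [Set.indicator, Set.mem_Ico, Set.mem_Ioc, abs_neg]
    congr 1
    apply propext
    constructor <;> rintro ⟨h1, h2⟩ <;> constructor <;> linarith
  have hsplit : Set.Icc (-R) R = Set.Ico (-R) 0 ∪ Set.Icc 0 R := by
    rw [Set.Ico_union_Icc_eq_Icc (by linarith) hR.le]
  rw [hsplit, lintegral_union measurableSet_Icc
    (Set.disjoint_left.2 fun x h1 h2 => absurd h1.2 (not_lt.2 h2.1)), hneg,
    setLIntegral_congr Ioc_ae_eq_Icc.symm, hpos,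
    ← ENNReal.ofReal_add (by have := sub_pos.2 ha; positivity)
      (by have := sub_pos.2 ha; positivity)]
  congr 1; ring

theorem enorm_integral_phase_mul_le (g : ℝ → ℂ) (a : ℝ) :
    ‖∫ η : ℝ, cexp (I * ((a * η : ℝ) : ℂ)) * g η‖ₑ ≤ ∫⁻ η, ‖g η‖ₑ := by
  refine (enorm_integral_le_lintegral_enorm _).trans (lintegral_mono fun η => ?_)
  rw [enorm_mul, enorm_exp_I_mul, one_mul]

theorem sq_lintegral_Icc_le {g : ℝ → ℂ} (hg : AEStronglyMeasurable g) {σ R : ℝ} (hσ : σ < 1 / 2)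
    (hR : 0 < R) :
    (∫⁻ η in Set.Icc (-R) R, ‖g η‖ₑ) ^ 2 ≤ ENNReal.ofReal (2 / (1 - 2 * σ) * R ^ (1 - 2 * σ)) *
      ∫⁻ η, ENNReal.ofReal (|η| ^ (2 * σ)) * ‖g η‖ₑ ^ 2 := by
  have key : ∫⁻ η in Set.Icc (-R) R, ‖g η‖ₑ = ∫⁻ η in Set.Icc (-R) R,
      ENNReal.ofReal (|η| ^ (-σ)) * (ENNReal.ofReal (|η| ^ σ) * ‖g η‖ₑ) := by
    refine lintegral_congr_ae (ae_restrict_of_ae ?_)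
    filter_upwards [Measure.ae_ne volume (0 : ℝ)] with η hη
    have := abs_pos.2 hη
    rw [← mul_assoc, ← ENNReal.ofReal_mul (by positivity), ← Real.rpow_add this]
    simp
  have hw : ∀ s : ℝ, Measurable fun η : ℝ => ENNReal.ofReal (|η| ^ s) := fun s => by fun_prop
  have hCS := lintegral_mul_le_l2n (ν := volume.restrict (Set.Icc (-R) R))
    (f := fun η => ENNReal.ofReal (|η| ^ (-σ))) (g := fun η => ENNReal.ofReal (|η| ^ σ) * ‖g η‖ₑ)
    (hw _).aemeasurable ((hw _).aemeasurable.mul hg.enorm.restrict)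
  rw [← key] at hCS
  refine (pow_le_pow_left' hCS 2).trans ?_
  rw [mul_pow, l2n_sq, l2n_sq]
  have hsq : ∀ (s η : ℝ), ENNReal.ofReal (|η| ^ s) ^ 2 = ENNReal.ofReal (|η| ^ (2 * s)) := by
    intro s η
    rw [← ENNReal.ofReal_pow (by positivity), ← Real.rpow_mul_natCast (abs_nonneg _), mul_comm]
    simp
  simp_rw [mul_pow, hsq]
  gcongr
  · rw [← lintegral_abs_rpow_neg_Icc (by linarith) hR]
    simp
  · exact Measure.restrict_le_self

/-- The constant of the homogeneous collapsing estimate. -/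
noncomputable def collapseConst (σ : ℝ) : ℝ := 2 * π + 2 * (2 / (1 - 2 * σ) + π)

theorem collapseConst_pos {σ : ℝ} (hσ : σ < 1 / 2) : 0 < collapseConst σ := by
  have : 0 < 1 - 2 * σ := by linarith
  unfold collapseConst
  positivity

theorem high_frequency_factor_le {ε σ T ζ : ℝ} (hε : 0 < ε) (hσ : 0 < σ) (hσ' : σ < 1 / 2)
    (hT : 0 < T) (hζ : ζ ≠ 0) (h : 1 ≤ T * ζ ^ 2) :
    |ζ| ^ (1 - 2 * ε) * (π / |ζ| * (ζ ^ 2 / 2) ^ (-σ)) ≤ collapseConst σ * T ^ (σ + ε) := by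
  have hz : 0 < |ζ| := abs_pos.2 hζ
  have h2 : (2 : ℝ) ^ σ ≤ 2 := by
    calc (2 : ℝ) ^ σ ≤ 2 ^ (1 : ℝ) := Real.rpow_le_rpow_of_exponent_le (by norm_num) (by linarith)
      _ = 2 := Real.rpow_one 2
  have e : |ζ| ^ (1 - 2 * ε) * (π / |ζ| * (ζ ^ 2 / 2) ^ (-σ)) =
      π * 2 ^ σ * (ζ ^ 2) ^ (-(σ + ε)) := by
    rw [Real.div_rpow (by positivity) (by norm_num), Real.rpow_neg (by norm_num : (0:ℝ) ≤ 2),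
      ← sq_abs, ← Real.rpow_natCast, ← Real.rpow_mul hz.le, ← Real.rpow_mul hz.le]
    rw [show |ζ| ^ (1 - 2 * ε) * (π / |ζ| * (|ζ| ^ (((2 : ℕ) : ℝ) * -σ) / (2 ^ σ)⁻¹)) =
      π * 2 ^ σ * (|ζ| ^ (1 - 2 * ε) / |ζ| * |ζ| ^ (((2 : ℕ) : ℝ) * -σ)) by field_simp]
    congr 1
    rw [← Real.rpow_sub_one hz.ne', ← Real.rpow_add hz]
    congr 1; push_cast; ring
  rw [e]
  have h3 : (ζ ^ 2) ^ (-(σ + ε)) ≤ T ^ (σ + ε) := by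
    rw [Real.rpow_neg (by positivity)]
    rw [inv_le_iff_one_le_mul₀ (by positivity), ← Real.mul_rpow hT.le (by positivity)]
    exact Real.one_le_rpow h (by positivity)
  have : 0 < 1 - 2 * σ := by linarith
  calc π * 2 ^ σ * (ζ ^ 2) ^ (-(σ + ε)) ≤ π * 2 * T ^ (σ + ε) := by gcongr
    _ ≤ collapseConst σ * T ^ (σ + ε) := by
      gcongr
      unfold collapseConst
      have : 0 < 2 * (2 / (1 - 2 * σ) + π) := by positivity
      linarith

theorem low_frequency_factor_le {ε σ T ζ : ℝ} (hε' : ε ≤ σ) (hσ' : σ < 1 / 2)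
    (hT : 0 < T) (hζ : ζ ≠ 0) (h : T * ζ ^ 2 ≤ 1) :
    |ζ| ^ (1 - 2 * ε) * (2 * (T * (2 / (1 - 2 * σ) * (1 / (|ζ| * T)) ^ (1 - 2 * σ)) +
      π / |ζ| * (1 / (|ζ| * T)) ^ (-(2 * σ)))) ≤ collapseConst σ * T ^ (σ + ε) := by
  have hz : 0 < |ζ| := abs_pos.2 hζ
  have hs : 0 < 1 - 2 * σ := by linarith
  have e1 : T * (1 / (|ζ| * T)) ^ (1 - 2 * σ) = T ^ (2 * σ) * |ζ| ^ (2 * σ - 1) := by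
    rw [one_div, ← Real.rpow_neg_eq_inv_rpow, Real.mul_rpow hz.le hT.le, neg_sub,
      Real.rpow_sub_one hT.ne']
    field_simp
  have e2 : 1 / |ζ| * (1 / (|ζ| * T)) ^ (-(2 * σ)) = T ^ (2 * σ) * |ζ| ^ (2 * σ - 1) := by
    rw [one_div (|ζ| * T), ← Real.rpow_neg_eq_inv_rpow, Real.mul_rpow hz.le hT.le, neg_neg,
      Real.rpow_sub_one hz.ne']
    field_simp
  have e3 : |ζ| ^ (1 - 2 * ε) * |ζ| ^ (2 * σ - 1) = (ζ ^ 2) ^ (σ - ε) := by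
    rw [← Real.rpow_add hz, ← sq_abs, ← Real.rpow_natCast, ← Real.rpow_mul hz.le]
    congr 1; push_cast; ring
  have e4 : T ^ (2 * σ) * (ζ ^ 2) ^ (σ - ε) ≤ T ^ (σ + ε) := by
    have : (ζ ^ 2) ^ (σ - ε) ≤ (1 / T) ^ (σ - ε) :=
      Real.rpow_le_rpow (by positivity) (by rw [le_div_iff₀ hT]; linarith) (by linarith)
    calc T ^ (2 * σ) * (ζ ^ 2) ^ (σ - ε) ≤ T ^ (2 * σ) * (1 / T) ^ (σ - ε) := by gcongr
      _ = T ^ (σ + ε) := by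
        rw [one_div, ← Real.rpow_neg_eq_inv_rpow, ← Real.rpow_add hT]
        congr 1; ring
  calc _ = 2 * (2 / (1 - 2 * σ) * (T * (1 / (|ζ| * T)) ^ (1 - 2 * σ)) +
        π * (1 / |ζ| * (1 / (|ζ| * T)) ^ (-(2 * σ)))) * |ζ| ^ (1 - 2 * ε) := by ring
    _ = 2 * (2 / (1 - 2 * σ) + π) * (T ^ (2 * σ) * (|ζ| ^ (1 - 2 * ε) * |ζ| ^ (2 * σ - 1))) := by
        rw [e1, e2]; ring
    _ ≤ 2 * (2 / (1 - 2 * σ) + π) * T ^ (σ + ε) := by rw [e3]; gcongr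
    _ ≤ collapseConst σ * T ^ (σ + ε) := by
      gcongr
      unfold collapseConst
      have := Real.pi_pos
      linarith

theorem enorm_add_sq_le (a b : ℂ) : ‖a + b‖ₑ ^ 2 ≤ 2 * (‖a‖ₑ ^ 2 + ‖b‖ₑ ^ 2) := by
  refine (pow_le_pow_left' (enorm_add_le a b) 2).trans ?_
  have := ENNReal.rpow_add_le_mul_rpow_add_rpow ‖a‖ₑ ‖b‖ₑ (p := 2) (by norm_num)
  norm_num at this
  exact this

theorem low_frequency_lintegral_le {g : ℝ → ℂ} (h1 : Integrable g) (h2 : MemLp g 2)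
    {σ T ζ R : ℝ} (hσ : 0 < σ) (hσ' : σ < 1 / 2) (hT : 0 < T) (hζ : ζ ≠ 0) (hR : 0 < R) :
    ∫⁻ τ in Set.Icc 0 T, ‖∫ η : ℝ, cexp (I * ((2 * τ * ζ * η : ℝ) : ℂ)) * g η‖ₑ ^ 2 ≤
      ENNReal.ofReal (2 * (T * (2 / (1 - 2 * σ) * R ^ (1 - 2 * σ)) + π / |ζ| * R ^ (-(2 * σ)))) *
        ∫⁻ η, ENNReal.ofReal (|η| ^ (2 * σ)) * ‖g η‖ₑ ^ 2 := by
  set W := ∫⁻ η, ENNReal.ofReal (|η| ^ (2 * σ)) * ‖g η‖ₑ ^ 2 with hW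
  have hs : 0 < 1 - 2 * σ := by linarith
  have hz : 0 < |ζ| := abs_pos.2 hζ
  set S := Set.Icc (-R) R
  have hS : MeasurableSet S := measurableSet_Icc
  have hlo := h1.indicator hS
  have hhi := h1.indicator hS.compl
  have hhi2 := h2.indicator hS.compl
  have split : ∀ τ : ℝ, ∫ η : ℝ, cexp (I * ((2 * τ * ζ * η : ℝ) : ℂ)) * g η =
      (∫ η : ℝ, cexp (I * ((2 * τ * ζ * η : ℝ) : ℂ)) * S.indicator g η) +
      ∫ η : ℝ, cexp (I * ((2 * τ * ζ * η : ℝ) : ℂ)) * Sᶜ.indicator g η := by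
    intro τ
    rw [← integral_add (integrable_phase_mul hlo (by fun_prop))
      (integrable_phase_mul hhi (by fun_prop))]
    congr 1; ext η
    rw [← mul_add]
    congr 1
    exact (congrFun (Set.indicator_self_add_compl S g) η).symm
  have hlow : ∀ τ : ℝ, ‖∫ η : ℝ, cexp (I * ((2 * τ * ζ * η : ℝ) : ℂ)) * S.indicator g η‖ₑ ^ 2 ≤
      ENNReal.ofReal (2 / (1 - 2 * σ) * R ^ (1 - 2 * σ)) * W := by
    intro τ
    refine le_trans (pow_le_pow_left' (enorm_integral_phase_mul_le _ _) 2) ?_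
    simp_rw [enorm_indicator_eq_indicator_enorm]
    rw [lintegral_indicator hS]
    exact sq_lintegral_Icc_le h1.aestronglyMeasurable hσ' hR
  have hhigh : ∫⁻ τ : ℝ, ‖∫ η : ℝ, cexp (I * ((2 * τ * ζ * η : ℝ) : ℂ)) * Sᶜ.indicator g η‖ₑ ^ 2 ≤
      ENNReal.ofReal (π / |ζ| * R ^ (-(2 * σ))) * W := by
    rw [lintegral_enorm_sq_exp_integral hhi hhi2 hζ, ENNReal.ofReal_mul (by positivity), mul_assoc]
    gcongr
    rw [hW, ← lintegral_const_mul' _ _ (by simp)]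
    refine lintegral_mono fun η => ?_
    by_cases hη : η ∈ S
    · simp [hη]
    · rw [Set.indicator_of_mem (by simpa using hη), ← mul_assoc,
        ← ENNReal.ofReal_mul (by positivity)]
      refine le_mul_of_one_le_left (by positivity) ?_
      rw [ENNReal.one_le_ofReal]
      have hηR : R ≤ |η| := by
        by_contra hcon
        exact hη (abs_le.1 (not_le.1 hcon).le)
      rw [Real.rpow_neg hR.le, ← div_eq_inv_mul, one_le_div (by positivity)]
      gcongr
  have hmeas : Measurable fun τ : ℝ =>
      ‖∫ η : ℝ, cexp (I * ((2 * τ * ζ * η : ℝ) : ℂ)) * S.indicator g η‖ₑ ^ 2 := by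
    refine Measurable.pow_const (Continuous.measurable (continuous_enorm.comp ?_)) 2
    refine continuous_of_dominated (bound := fun η => ‖S.indicator g η‖) ?_ ?_ hlo.norm ?_
    · intro τ
      exact (integrable_phase_mul hlo (by fun_prop)).aestronglyMeasurable
    · intro τ
      refine Filter.Eventually.of_forall fun η => ?_
      rw [norm_mul, mul_comm I, Complex.norm_exp_ofReal_mul_I, one_mul]
    · exact Filter.Eventually.of_forall fun η => by fun_prop
  calc ∫⁻ τ in Set.Icc 0 T, ‖∫ η : ℝ, cexp (I * ((2 * τ * ζ * η : ℝ) : ℂ)) * g η‖ₑ ^ 2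
      ≤ ∫⁻ τ in Set.Icc 0 T, 2 *
        (‖∫ η : ℝ, cexp (I * ((2 * τ * ζ * η : ℝ) : ℂ)) * S.indicator g η‖ₑ ^ 2 +
          ‖∫ η : ℝ, cexp (I * ((2 * τ * ζ * η : ℝ) : ℂ)) * Sᶜ.indicator g η‖ₑ ^ 2) := by
        refine lintegral_mono fun τ => ?_
        rw [split τ]
        exact enorm_add_sq_le _ _
    _ ≤ 2 * ((∫⁻ _ in Set.Icc 0 T, ENNReal.ofReal (2 / (1 - 2 * σ) * R ^ (1 - 2 * σ)) * W) +
          ENNReal.ofReal (π / |ζ| * R ^ (-(2 * σ))) * W) := by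
        rw [lintegral_const_mul' _ _ (by simp), lintegral_add_left hmeas]
        gcongr with τ
        · exact hlow τ
        · exact (setLIntegral_le_lintegral _ _).trans hhigh
    _ = _ := by
        rw [setLIntegral_const, Real.volume_Icc, sub_zero,
          ENNReal.ofReal_mul (p := 2) (by norm_num),
          ENNReal.ofReal_add (by positivity) (by positivity), ENNReal.ofReal_mul hT.le,
          ENNReal.ofReal_ofNat]
        ring

theorem collapse_fixed_frequency {g : ℝ → ℂ} (h1 : Integrable g) (h2 : MemLp g 2)
    {ε σ T ζ : ℝ} {w : ℝ → ℝ} (hε : 0 < ε) (hε2 : ε < 1 / 2) (hεσ : ε ≤ σ) (hσ' : σ < 1 / 2)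
    (hT : 0 < T) (hw1 : ∀ η, |η| ^ (2 * σ) ≤ w η) (hw2 : ∀ η, (ζ ^ 2 / 2) ^ σ ≤ w η) :
    ENNReal.ofReal (|ζ| ^ (1 - 2 * ε)) *
      ∫⁻ τ in Set.Icc 0 T, ‖∫ η : ℝ, cexp (I * ((2 * τ * ζ * η : ℝ) : ℂ)) * g η‖ₑ ^ 2 ≤
      ENNReal.ofReal (collapseConst σ * T ^ (σ + ε)) * ∫⁻ η, ENNReal.ofReal (w η) * ‖g η‖ₑ ^ 2 := by
  have hσ : 0 < σ := by linarith
  rcases eq_or_ne ζ 0 with rfl | hζ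
  · simp [Real.zero_rpow (show 1 - 2 * ε ≠ 0 by linarith)]
  have hz : 0 < |ζ| := abs_pos.2 hζ
  rcases le_total 1 (T * ζ ^ 2) with h | h
  · refine le_trans ?_ (mul_le_mul_left (ENNReal.ofReal_le_ofReal
      (high_frequency_factor_le hε hσ hσ' hT hζ h)) _)
    rw [ENNReal.ofReal_mul (by positivity), mul_assoc]
    gcongr
    refine (setLIntegral_le_lintegral _ _).trans ?_
    rw [lintegral_enorm_sq_exp_integral h1 h2 hζ, ENNReal.ofReal_mul (by positivity), mul_assoc]
    gcongr
    rw [← lintegral_const_mul' _ _ (by simp)]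
    refine lintegral_mono fun η => ?_
    rw [← mul_assoc, ← ENNReal.ofReal_mul (by positivity)]
    refine le_mul_of_one_le_left (by positivity) ?_
    rw [ENNReal.one_le_ofReal, Real.rpow_neg (by positivity), ← div_eq_inv_mul,
      one_le_div (by positivity)]
    exact hw2 η
  · refine le_trans ?_ (mul_le_mul_left (ENNReal.ofReal_le_ofReal
      (low_frequency_factor_le hεσ hσ' hT hζ h)) _)
    rw [ENNReal.ofReal_mul (by positivity), mul_assoc]
    gcongr
    refine (low_frequency_lintegral_le h1 h2 hσ hσ' hT hζ (R := 1 / (|ζ| * T))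
      (by positivity)).trans ?_
    gcongr with η
    exact hw1 η

/-- Continuous kernels with polynomial decay. -/
structure KernelDecay (C : ℝ) (h : ℝ → ℝ → ℂ) : Prop where
  continuous : Continuous fun p : ℝ × ℝ => h p.1 p.2
  bound : ∀ ξ η, ‖h ξ η‖ ≤ C * (((1 + ξ ^ 2) ^ 3)⁻¹ * ((1 + η ^ 2) ^ 3)⁻¹)

theorem integrable_and_memLp_two_of_bound {α : Type*} [MeasurableSpace α] {μ : Measure α}
    {f : α → ℂ} {g : α → ℝ} {C : ℝ} (hf : AEStronglyMeasurable f μ) (hg : Integrable g μ)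
    (hfg : ∀ a, ‖f a‖ ≤ g a) (hgC : ∀ a, g a ≤ C) : Integrable f μ ∧ MemLp f 2 μ := by
  have hi : Integrable f μ := hg.mono' hf (Filter.Eventually.of_forall hfg)
  refine ⟨hi, (memLp_two_iff_integrable_sq_norm hf).2 ?_⟩
  refine (hi.norm.const_mul C).mono' (hf.norm.pow 2) (Filter.Eventually.of_forall fun a => ?_)
  rw [Real.norm_of_nonneg (by positivity), sq]
  gcongr
  exact (hfg a).trans (hgC a)

theorem inv_one_add_sq_le_one (x : ℝ) : (1 + x ^ 2)⁻¹ ≤ 1 :=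
  inv_le_one_of_one_le₀ (by nlinarith [sq_nonneg x])

theorem integrable_inv_one_add_sq_prod :
    Integrable fun p : ℝ × ℝ => (1 + p.1 ^ 2)⁻¹ * (1 + p.2 ^ 2)⁻¹ :=
  integrable_inv_one_add_sq.mul_prod integrable_inv_one_add_sq

theorem rpow_le_one_add_sq_mul {σ : ℝ} (h0 : 0 ≤ σ) (h1 : σ ≤ 1) (ξ η : ℝ) :
    (ξ ^ 2 + η ^ 2) ^ (σ / 2) ≤ (1 + ξ ^ 2) * (1 + η ^ 2) := by
  calc (ξ ^ 2 + η ^ 2) ^ (σ / 2) ≤ ((1 + ξ ^ 2) * (1 + η ^ 2)) ^ (σ / 2) := by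
        refine Real.rpow_le_rpow (by positivity) ?_ (by positivity)
        nlinarith [mul_nonneg (sq_nonneg ξ) (sq_nonneg η)]
    _ ≤ ((1 + ξ ^ 2) * (1 + η ^ 2)) ^ (1 : ℝ) := by
        refine Real.rpow_le_rpow_of_exponent_le ?_ (by linarith)
        nlinarith [mul_nonneg (sq_nonneg ξ) (sq_nonneg η), sq_nonneg ξ, sq_nonneg η]
    _ = _ := Real.rpow_one _

theorem abs_rpow_le_one_add_sq {s : ℝ} (h0 : 0 ≤ s) (h1 : s ≤ 1) (ζ : ℝ) :
    |ζ| ^ s ≤ 1 + ζ ^ 2 := by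
  calc |ζ| ^ s ≤ (1 + ζ ^ 2) ^ s := by
        refine Real.rpow_le_rpow (by positivity) ?_ h0
        nlinarith [sq_abs ζ, sq_nonneg (|ζ| - 1), abs_nonneg ζ]
    _ ≤ (1 + ζ ^ 2) ^ (1 : ℝ) :=
        Real.rpow_le_rpow_of_exponent_le (by nlinarith [sq_nonneg ζ]) h1
    _ = _ := Real.rpow_one _

namespace KernelDecay

variable {C : ℝ} {h : ℝ → ℝ → ℂ}

theorem const_nonneg (hh : KernelDecay C h) : 0 ≤ C := by
  have := (norm_nonneg _).trans (hh.bound 0 0)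
  simpa using this

theorem bound' (hh : KernelDecay C h) (ξ η : ℝ) :
    ‖h ξ η‖ ≤ C * ((1 + ξ ^ 2)⁻¹ * (1 + η ^ 2)⁻¹) := by
  have := hh.const_nonneg
  refine (hh.bound ξ η).trans ?_
  gcongr <;> exact le_self_pow₀ (by nlinarith [sq_nonneg ξ, sq_nonneg η]) (by norm_num)

theorem const_mul_le (hh : KernelDecay C h) (ξ η : ℝ) :
    C * ((1 + ξ ^ 2)⁻¹ * (1 + η ^ 2)⁻¹) ≤ C := by
  refine mul_le_of_le_one_right hh.const_nonneg ?_
  exact mul_le_one₀ (inv_one_add_sq_le_one _) (by positivity) (inv_one_add_sq_le_one _)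

theorem integrable (hh : KernelDecay C h) : Integrable fun p : ℝ × ℝ => h p.1 p.2 :=
  (integrable_and_memLp_two_of_bound hh.continuous.aestronglyMeasurable
    (integrable_inv_one_add_sq_prod.const_mul C) (fun p => hh.bound' p.1 p.2)
    (fun p => hh.const_mul_le p.1 p.2)).1

theorem integrable_diag (hh : KernelDecay C h) : Integrable fun x : ℝ => h x x := by
  have := hh.const_nonneg
  refine (integrable_inv_one_add_sq.const_mul C).mono'
    ((hh.continuous.comp (continuous_id.prodMk continuous_id)).aestronglyMeasurable)
    (Filter.Eventually.of_forall fun x => (hh.bound' x x).trans ?_)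
  gcongr
  exact mul_le_of_le_one_left (by positivity) (inv_one_add_sq_le_one _)

theorem weighted (hh : KernelDecay C h) {σ : ℝ} (h0 : 0 ≤ σ) (h1 : σ ≤ 1) :
    Integrable (fun p : ℝ × ℝ => (((p.1 ^ 2 + p.2 ^ 2) ^ (σ / 2) : ℝ) : ℂ) * h p.1 p.2) ∧
    MemLp (fun p : ℝ × ℝ => (((p.1 ^ 2 + p.2 ^ 2) ^ (σ / 2) : ℝ) : ℂ) * h p.1 p.2) 2 := by
  refine integrable_and_memLp_two_of_bound ?_ (integrable_inv_one_add_sq_prod.const_mul C) ?_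
    (fun p => hh.const_mul_le p.1 p.2)
  · exact (Measurable.aestronglyMeasurable (by fun_prop)).mul hh.continuous.aestronglyMeasurable
  · intro p
    rw [norm_mul, Complex.norm_real, Real.norm_of_nonneg (by positivity)]
    have := hh.const_nonneg
    calc _ ≤ ((1 + p.1 ^ 2) * (1 + p.2 ^ 2)) *
          (C * (((1 + p.1 ^ 2) ^ 3)⁻¹ * ((1 + p.2 ^ 2) ^ 3)⁻¹)) := by
          gcongr
          · exact rpow_le_one_add_sq_mul h0 h1 _ _
          · exact hh.bound _ _
      _ = C * (((1 + p.1 ^ 2) ^ 2)⁻¹ * ((1 + p.2 ^ 2) ^ 2)⁻¹) := by field_simp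
      _ ≤ _ := by
          gcongr <;> exact le_self_pow₀ (by nlinarith [sq_nonneg p.1, sq_nonneg p.2]) (by norm_num)

theorem bound_antidiag (hh : KernelDecay C h) (ζ η : ℝ) :
    ‖h (ζ - η) η‖ ≤ 4 * C * ((1 + ζ ^ 2) ^ 2)⁻¹ * (1 + η ^ 2)⁻¹ := by
  have := hh.const_nonneg
  have key : 1 + ζ ^ 2 ≤ 2 * ((1 + (ζ - η) ^ 2) * (1 + η ^ 2)) := by
    nlinarith [sq_nonneg (ζ - 2 * η), sq_nonneg ((ζ - η) * η)]
  refine (hh.bound _ _).trans ?_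
  have h1 : ((1 + (ζ - η) ^ 2) ^ 3)⁻¹ * ((1 + η ^ 2) ^ 3)⁻¹ ≤
      (((1 + (ζ - η) ^ 2) * (1 + η ^ 2)) ^ 2)⁻¹ * (1 + η ^ 2)⁻¹ := by
    rw [← mul_inv, ← mul_inv]
    refine inv_anti₀ (by positivity) ?_
    calc ((1 + (ζ - η) ^ 2) * (1 + η ^ 2)) ^ 2 * (1 + η ^ 2) =
        (1 + (ζ - η) ^ 2) ^ 2 * (1 + η ^ 2) ^ 3 := by ring
      _ ≤ _ := by
        gcongr
        · nlinarith [sq_nonneg (ζ - η)]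
        · norm_num
  have h2 : (((1 + (ζ - η) ^ 2) * (1 + η ^ 2)) ^ 2)⁻¹ ≤ 4 * ((1 + ζ ^ 2) ^ 2)⁻¹ := by
    rw [inv_le_iff_one_le_mul₀ (by positivity)]
    rw [show 4 * ((1 + ζ ^ 2) ^ 2)⁻¹ * ((1 + (ζ - η) ^ 2) * (1 + η ^ 2)) ^ 2 =
      (2 * ((1 + (ζ - η) ^ 2) * (1 + η ^ 2))) ^ 2 / (1 + ζ ^ 2) ^ 2 by field_simp; ring]
    rw [one_le_div (by positivity)]
    gcongr
  calc _ ≤ C * (4 * ((1 + ζ ^ 2) ^ 2)⁻¹ * (1 + η ^ 2)⁻¹) := by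
        refine mul_le_mul_of_nonneg_left (h1.trans ?_) this
        gcongr
    _ = _ := by ring

theorem continuous_antidiag (hh : KernelDecay C h) :
    Continuous fun q : ℝ × ℝ => h (q.1 - q.2) q.2 :=
  hh.continuous.comp (by fun_prop : Continuous fun q : ℝ × ℝ => (q.1 - q.2, q.2))

theorem antidiag (hh : KernelDecay C h) (ζ : ℝ) :
    Integrable (fun η => h (ζ - η) η) ∧ MemLp (fun η => h (ζ - η) η) 2 := by
  have := hh.const_nonneg
  refine integrable_and_memLp_two_of_bound (C := 4 * C * ((1 + ζ ^ 2) ^ 2)⁻¹)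
    (hh.continuous_antidiag.comp
      (by fun_prop : Continuous fun η : ℝ => (ζ, η))).aestronglyMeasurable
    (integrable_inv_one_add_sq.const_mul (4 * C * ((1 + ζ ^ 2) ^ 2)⁻¹))
    (fun η => hh.bound_antidiag ζ η) fun η => ?_
  exact mul_le_of_le_one_right (by positivity) (inv_one_add_sq_le_one _)

/-- The integral of a decaying kernel along antidiagonals is continuous. -/
theorem continuous_integral_antidiag (hh : KernelDecay C h) :
    Continuous fun ζ => ∫ η, h (ζ - η) η := by
  have := hh.const_nonneg
  refine continuous_of_dominated (bound := fun η => 4 * C * (1 + η ^ 2)⁻¹)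
    (fun ζ => (hh.antidiag ζ).1.aestronglyMeasurable) ?_
    (integrable_inv_one_add_sq.const_mul _) ?_
  · refine fun ζ => Filter.Eventually.of_forall fun η => (hh.bound_antidiag ζ η).trans ?_
    refine mul_le_mul_of_nonneg_right ?_ (by positivity)
    refine mul_le_of_le_one_right (by positivity) (inv_le_one_of_one_le₀ ?_)
    exact one_le_pow₀ (by nlinarith [sq_nonneg ζ])
  · exact Filter.Eventually.of_forall fun η =>
      hh.continuous_antidiag.comp (by fun_prop : Continuous fun ζ : ℝ => (ζ, η))

theorem norm_integral_antidiag_le (hh : KernelDecay C h) (ζ : ℝ) :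
    ‖∫ η, h (ζ - η) η‖ ≤ 4 * C * π * ((1 + ζ ^ 2) ^ 2)⁻¹ := by
  have := norm_integral_le_of_norm_le (integrable_inv_one_add_sq.const_mul
    (4 * C * ((1 + ζ ^ 2) ^ 2)⁻¹)) (Filter.Eventually.of_forall fun η => hh.bound_antidiag ζ η)
  rw [integral_const_mul, integral_univ_inv_one_add_sq] at this
  linarith

theorem weighted_integral_antidiag (hh : KernelDecay C h) {s : ℝ} (h0 : 0 ≤ s) (h1 : s ≤ 1)
    (c : ℂ) :
    Integrable (fun ζ => ((|ζ| ^ s : ℝ) : ℂ) * (c * ∫ η, h (ζ - η) η)) ∧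
    MemLp (fun ζ => ((|ζ| ^ s : ℝ) : ℂ) * (c * ∫ η, h (ζ - η) η)) 2 := by
  have := hh.const_nonneg
  refine integrable_and_memLp_two_of_bound (C := ‖c‖ * (4 * C * π)) ?_
    (integrable_inv_one_add_sq.const_mul (‖c‖ * (4 * C * π))) ?_ ?_
  · exact (Measurable.aestronglyMeasurable (by fun_prop)).mul
      (hh.continuous_integral_antidiag.const_mul c).aestronglyMeasurable
  · intro ζ
    rw [norm_mul, norm_mul, Complex.norm_real, Real.norm_of_nonneg (by positivity)]
    calc _ ≤ (1 + ζ ^ 2) * (‖c‖ * (4 * C * π * ((1 + ζ ^ 2) ^ 2)⁻¹)) := by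
          gcongr
          · exact abs_rpow_le_one_add_sq h0 h1 ζ
          · exact hh.norm_integral_antidiag_le ζ
      _ = _ := by field_simp
  · exact fun ζ => mul_le_of_le_one_right (by positivity) (inv_one_add_sq_le_one _)

theorem phase_mul (hh : KernelDecay C h) {θ : ℝ → ℝ → ℝ}
    (hθ : Continuous fun p : ℝ × ℝ => θ p.1 p.2) :
    KernelDecay C fun ξ η => cexp (I * (θ ξ η : ℂ)) * h ξ η where
  continuous := by
    have := hh.continuous
    fun_prop
  bound ξ η := by
    rw [norm_mul, mul_comm I, Complex.norm_exp_ofReal_mul_I, one_mul]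
    exact hh.bound ξ η

end KernelDecay

/-- The Fourier transform, up to a factor `2π`, of the density of the kernel with Fourier transform
`h`, propagated freely for time `τ`. -/
noncomputable def collapse (τ : ℝ) (h : ℝ → ℝ → ℂ) (ζ : ℝ) : ℂ :=
  ∫ η : ℝ, cexp (I * ((τ * (η ^ 2 - (ζ - η) ^ 2) : ℝ) : ℂ)) * h (ζ - η) η

/-- The homogeneous Sobolev norm on the Fourier side. -/
noncomputable def weightedNorm (σ : ℝ) (h : ℝ → ℝ → ℂ) : ℝ≥0∞ :=
  l2n volume fun p : ℝ × ℝ => ENNReal.ofReal ((p.1 ^ 2 + p.2 ^ 2) ^ (σ / 2)) * ‖h p.1 p.2‖ₑ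

theorem ofReal_rpow_half_sq {x : ℝ} (hx : 0 ≤ x) (σ : ℝ) :
    ENNReal.ofReal (x ^ (σ / 2)) ^ 2 = ENNReal.ofReal (x ^ σ) := by
  rw [← ENNReal.ofReal_pow (by positivity), ← Real.rpow_mul_natCast hx]
  congr 2; push_cast; ring

theorem enorm_collapse (τ : ℝ) (h : ℝ → ℝ → ℂ) (ζ : ℝ) :
    ‖collapse τ h ζ‖ₑ = ‖∫ η : ℝ, cexp (I * ((2 * τ * ζ * η : ℝ) : ℂ)) * h (ζ - η) η‖ₑ := by
  have : collapse τ h ζ = cexp (I * ((-(τ * ζ ^ 2) : ℝ) : ℂ)) *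
      ∫ η : ℝ, cexp (I * ((2 * τ * ζ * η : ℝ) : ℂ)) * h (ζ - η) η := by
    rw [collapse, ← integral_const_mul]
    congr 1; ext η
    rw [← mul_assoc, ← Complex.exp_add]
    congr 2
    push_cast; ring
  rw [this, enorm_mul, enorm_exp_I_mul, one_mul]

theorem KernelDecay.stronglyMeasurable_collapse {C : ℝ} {h : ℝ → ℝ → ℂ} (hh : KernelDecay C h) :
    StronglyMeasurable fun q : ℝ × ℝ => collapse q.1 h q.2 := by
  have hc := hh.continuous_antidiag.comp
    (by fun_prop : Continuous fun q : (ℝ × ℝ) × ℝ => (q.1.2, q.2))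
  refine StronglyMeasurable.integral_prod_right' (f := fun q : (ℝ × ℝ) × ℝ =>
    cexp (I * ((q.1.1 * (q.2 ^ 2 - (q.1.2 - q.2) ^ 2) : ℝ) : ℂ)) * h (q.1.2 - q.2) q.2) ?_
  refine Continuous.stronglyMeasurable ?_
  exact Continuous.mul (by fun_prop) hc

theorem lintegral_antidiag {f : ℝ × ℝ → ℝ≥0∞} (hf : Measurable f) :
    ∫⁻ ζ, ∫⁻ η, f (ζ - η, η) = ∫⁻ p, f p := by
  rw [lintegral_lintegral_swap (f := fun ζ η => f (ζ - η, η))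
    (hf.comp (by fun_prop : Measurable fun q : ℝ × ℝ => (q.1 - q.2, q.2))).aemeasurable,
    Measure.volume_eq_prod, lintegral_prod_symm' f hf]
  refine lintegral_congr fun η => ?_
  exact lintegral_sub_right_eq_self (fun x => f (x, η)) η

/-- The collapsing estimate for the free evolution, on the Fourier side. -/
theorem KernelDecay.collapse_le {C : ℝ} {h : ℝ → ℝ → ℂ} (hh : KernelDecay C h) {ε σ T : ℝ}
    (hε : 0 < ε) (hε2 : ε < 1 / 2) (hεσ : ε ≤ σ) (hσ' : σ < 1 / 2) (hT : 0 < T) :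
    l2n ((volume.restrict (Set.Icc 0 T)).prod volume)
      (fun q : ℝ × ℝ => ENNReal.ofReal (|q.2| ^ (1 / 2 - ε)) * ‖collapse q.1 h q.2‖ₑ) ≤
      ENNReal.ofReal (√(collapseConst σ) * T ^ ((σ + ε) / 2)) * weightedNorm σ h := by
  rw [l2n_le_iff, mul_pow, weightedNorm, l2n_sq]
  have hK : ENNReal.ofReal (√(collapseConst σ) * T ^ ((σ + ε) / 2)) ^ 2 =
      ENNReal.ofReal (collapseConst σ * T ^ (σ + ε)) := by
    rw [ENNReal.ofReal_mul (by positivity), mul_pow, ofReal_rpow_half_sq hT.le,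
      ← ENNReal.ofReal_pow (by positivity), Real.sq_sqrt (collapseConst_pos hσ').le,
      ENNReal.ofReal_mul (collapseConst_pos hσ').le]
  have hz : ∀ ζ : ℝ, ENNReal.ofReal (|ζ| ^ (1 / 2 - ε)) ^ 2 =
      ENNReal.ofReal (|ζ| ^ (1 - 2 * ε)) := fun ζ => by
    rw [← ofReal_rpow_half_sq (abs_nonneg ζ) (1 - 2 * ε)]; congr 3; ring
  have hm : Measurable fun q : ℝ × ℝ =>
      (ENNReal.ofReal (|q.2| ^ (1 / 2 - ε)) * ‖collapse q.1 h q.2‖ₑ) ^ 2 :=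
    (Measurable.mul (by fun_prop) hh.stronglyMeasurable_collapse.measurable.enorm).pow_const 2
  rw [hK, lintegral_prod_symm' _ hm]
  simp_rw [mul_pow, hz, enorm_collapse]
  have hm2 : Measurable fun p : ℝ × ℝ =>
      ENNReal.ofReal ((p.1 ^ 2 + p.2 ^ 2) ^ (σ / 2)) ^ 2 * ‖h p.1 p.2‖ₑ ^ 2 :=
    Measurable.mul (by fun_prop) (hh.continuous.measurable.enorm.pow_const 2)
  rw [← lintegral_antidiag hm2, ← lintegral_const_mul' _ _ (by simp)]
  refine lintegral_mono fun ζ => ?_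
  dsimp only
  rw [lintegral_const_mul' _ _ (by simp)]
  have hsq : ∀ η : ℝ, ENNReal.ofReal (((ζ - η) ^ 2 + η ^ 2) ^ (σ / 2)) ^ 2 =
      ENNReal.ofReal (((ζ - η) ^ 2 + η ^ 2) ^ σ) := fun η => ofReal_rpow_half_sq (by positivity) σ
  simp_rw [hsq]
  refine collapse_fixed_frequency (hh.antidiag ζ).1 (hh.antidiag ζ).2 hε hε2 hεσ hσ' hT
    (w := fun η => ((ζ - η) ^ 2 + η ^ 2) ^ σ) (fun η => ?_) fun η => ?_
  · rw [Real.rpow_mul (abs_nonneg _), Real.rpow_two, sq_abs]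
    refine Real.rpow_le_rpow (by positivity) (by nlinarith [sq_nonneg (ζ - η)]) (by linarith)
  · refine Real.rpow_le_rpow (by positivity) (by nlinarith [sq_nonneg (ζ - 2 * η)]) (by linarith)

/-- Jointly continuous families of kernels with uniform polynomial decay. -/
structure FamilyDecay (C : ℝ) (H : ℝ → ℝ → ℝ → ℂ) : Prop where
  continuous : Continuous fun q : ℝ × ℝ × ℝ => H q.1 q.2.1 q.2.2
  bound : ∀ s ξ η, ‖H s ξ η‖ ≤ C * (((1 + ξ ^ 2) ^ 3)⁻¹ * ((1 + η ^ 2) ^ 3)⁻¹)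

theorem FamilyDecay.slice {C : ℝ} {H : ℝ → ℝ → ℝ → ℂ} (hH : FamilyDecay C H) (s : ℝ) :
    KernelDecay C (H s) where
  continuous := hH.continuous.comp (by fun_prop : Continuous fun p : ℝ × ℝ => (s, p.1, p.2))
  bound := hH.bound s

/-- The Fourier transform of the Duhamel solution. -/
noncomputable def duhamelHat (h : ℝ → ℝ → ℂ) (H : ℝ → ℝ → ℝ → ℂ) (t ξ η : ℝ) : ℂ :=
  cexp (I * ((t * (η ^ 2 - ξ ^ 2) : ℝ) : ℂ)) * h ξ η +
    I * ∫ s in (0 : ℝ)..t, cexp (I * (((t - s) * (η ^ 2 - ξ ^ 2) : ℝ) : ℂ)) * H s ξ η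

theorem FamilyDecay.integral_decay {C : ℝ} {H : ℝ → ℝ → ℝ → ℂ} (hH : FamilyDecay C H)
    {t : ℝ} (ht0 : 0 ≤ t) (ht1 : t ≤ 1) :
    KernelDecay C fun ξ η => I * ∫ s in (0 : ℝ)..t, H s ξ η where
  continuous := by
    refine Continuous.const_mul ?_ I
    exact intervalIntegral.continuous_parametric_intervalIntegral_of_continuous'
      (f := fun (p : ℝ × ℝ) s => H s p.1 p.2)
      (hH.continuous.comp (by fun_prop : Continuous fun q : (ℝ × ℝ) × ℝ => (q.2, q.1.1, q.1.2))) 0 t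
  bound ξ η := by
    rw [norm_mul, norm_I, one_mul]
    have := intervalIntegral.norm_integral_le_of_norm_le_const (a := 0) (b := t)
      (f := fun s => H s ξ η) (fun s _ => hH.bound s ξ η)
    refine this.trans ?_
    rw [sub_zero, abs_of_nonneg ht0]
    exact mul_le_of_le_one_right ((norm_nonneg _).trans (hH.bound 0 ξ η)) ht1

theorem FamilyDecay.phase_mul {C : ℝ} {H : ℝ → ℝ → ℝ → ℂ} (hH : FamilyDecay C H)
    {θ : ℝ → ℝ → ℝ → ℝ} (hθ : Continuous fun q : ℝ × ℝ × ℝ => θ q.1 q.2.1 q.2.2) :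
    FamilyDecay C fun s ξ η => cexp (I * (θ s ξ η : ℂ)) * H s ξ η where
  continuous := by
    have := hH.continuous
    fun_prop
  bound s ξ η := by
    rw [norm_mul, mul_comm I, Complex.norm_exp_ofReal_mul_I, one_mul]
    exact hH.bound s ξ η

theorem KernelDecay.add {C C' : ℝ} {h h' : ℝ → ℝ → ℂ} (hh : KernelDecay C h)
    (hh' : KernelDecay C' h') : KernelDecay (C + C') fun ξ η => h ξ η + h' ξ η where
  continuous := hh.continuous.add hh'.continuous
  bound ξ η := by
    rw [add_mul]
    exact (norm_add_le _ _).trans (add_le_add (hh.bound ξ η) (hh'.bound ξ η))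

theorem KernelDecay.decay_duhamelHat {C C' : ℝ} {h : ℝ → ℝ → ℂ} {H : ℝ → ℝ → ℝ → ℂ}
    (hh : KernelDecay C h) (hH : FamilyDecay C' H) {t : ℝ} (ht0 : 0 ≤ t) (ht1 : t ≤ 1) :
    KernelDecay (C + C') (duhamelHat h H t) :=
  (hh.phase_mul (θ := fun ξ η => t * (η ^ 2 - ξ ^ 2)) (by fun_prop)).add
    ((hH.phase_mul (θ := fun s ξ η => (t - s) * (η ^ 2 - ξ ^ 2)) (by fun_prop)).integral_decay
      ht0 ht1)

theorem integral_intervalIntegral_swap_of_bound {α : Type*} [MeasurableSpace α] {μ : Measure α}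
    [SFinite μ] {K : ℝ → α → ℂ} {g : α → ℝ} {t : ℝ} (ht : 0 ≤ t)
    (hK : StronglyMeasurable (Function.uncurry K)) (hg : Integrable g μ)
    (hb : ∀ s a, ‖K s a‖ ≤ g a) :
    Integrable (fun a => ∫ s in (0 : ℝ)..t, K s a) μ ∧
    ∫ a, (∫ s in (0 : ℝ)..t, K s a) ∂μ = ∫ s in (0 : ℝ)..t, (∫ a, K s a ∂μ) := by
  simp_rw [intervalIntegral.integral_of_le ht]
  have hi : Integrable (Function.uncurry K) ((volume.restrict (Set.Ioc 0 t)).prod μ) := by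
    have h1 : Integrable (fun _ : ℝ => (1 : ℝ)) (volume.restrict (Set.Ioc 0 t)) :=
      integrable_const 1
    refine (h1.mul_prod hg).mono' hK.aestronglyMeasurable
      (Filter.Eventually.of_forall fun p => ?_)
    rw [one_mul]
    exact hb p.1 p.2
  exact ⟨hi.integral_prod_right, (integral_integral_swap hi).symm⟩

theorem integral_antidiag_duhamelHat {C C' : ℝ} {h : ℝ → ℝ → ℂ} {H : ℝ → ℝ → ℝ → ℂ}
    (hh : KernelDecay C h) (hH : FamilyDecay C' H) {t : ℝ} (ht0 : 0 ≤ t) (ζ : ℝ) :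
    ∫ η, duhamelHat h H t (ζ - η) η =
      collapse t h ζ + I * ∫ s in (0 : ℝ)..t, collapse (t - s) (H s) ζ := by
  have hp := hH.phase_mul (θ := fun s ξ η => (t - s) * (η ^ 2 - ξ ^ 2)) (by fun_prop)
  have hsw := integral_intervalIntegral_swap_of_bound (μ := volume) ht0
    (K := fun s η => cexp (I * (((t - s) * (η ^ 2 - (ζ - η) ^ 2) : ℝ) : ℂ)) * H s (ζ - η) η)
    (hp.continuous.comp (by fun_prop : Continuous fun q : ℝ × ℝ =>
      (q.1, ζ - q.2, q.2))).stronglyMeasurable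
    (integrable_inv_one_add_sq.const_mul (4 * C' * ((1 + ζ ^ 2) ^ 2)⁻¹))
    (fun s η => (hp.slice s).bound_antidiag ζ η)
  unfold duhamelHat
  rw [integral_add, integral_const_mul, hsw.2]
  · rfl
  · exact integrable_phase_mul (hh.antidiag ζ).1 (θ := fun η => t * (η ^ 2 - (ζ - η) ^ 2))
      (by fun_prop)
  · exact hsw.1.const_mul I

theorem FamilyDecay.stronglyMeasurable_collapse {C : ℝ} {H : ℝ → ℝ → ℝ → ℂ}
    (hH : FamilyDecay C H) :
    StronglyMeasurable fun q : ℝ × ℝ × ℝ => collapse (q.2.1 - q.1) (H q.1) q.2.2 := by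
  have hc := hH.continuous.comp
    (by fun_prop : Continuous fun q : (ℝ × ℝ × ℝ) × ℝ => (q.1.1, q.1.2.2 - q.2, q.2))
  refine StronglyMeasurable.integral_prod_right' (f := fun q : (ℝ × ℝ × ℝ) × ℝ =>
    cexp (I * (((q.1.2.1 - q.1.1) * (q.2 ^ 2 - (q.1.2.2 - q.2) ^ 2) : ℝ) : ℂ)) *
      H q.1.1 (q.1.2.2 - q.2) q.2) ?_
  refine Continuous.stronglyMeasurable ?_
  exact Continuous.mul (by fun_prop) hc

theorem enorm_intervalIntegral_le {t T : ℝ} (ht0 : 0 ≤ t) (htT : t ≤ T) (g : ℝ → ℂ) :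
    ‖∫ s in (0 : ℝ)..t, g s‖ₑ ≤ ∫⁻ s in Set.Icc 0 T, if s ≤ t then ‖g s‖ₑ else 0 := by
  rw [intervalIntegral.integral_of_le ht0]
  refine (enorm_integral_le_lintegral_enorm _).trans ?_
  refine le_trans (setLIntegral_mono' (g := fun s => if s ≤ t then ‖g s‖ₑ else 0)
    measurableSet_Ioc fun s hs => ?_) (lintegral_mono_set fun s hs => ⟨hs.1.le, hs.2.trans htT⟩)
  simp [hs.2]

theorem FamilyDecay.collapse_shift_le {C : ℝ} {H : ℝ → ℝ → ℝ → ℂ} (hH : FamilyDecay C H)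
    (T r s : ℝ) (hs : 0 ≤ s) :
    l2n ((volume.restrict (Set.Icc 0 T)).prod volume) (fun q : ℝ × ℝ =>
        ENNReal.ofReal (|q.2| ^ r) * if s ≤ q.1 then ‖collapse (q.1 - s) (H s) q.2‖ₑ else 0) ≤
      l2n ((volume.restrict (Set.Icc 0 T)).prod volume) (fun q : ℝ × ℝ =>
        ENNReal.ofReal (|q.2| ^ r) * ‖collapse q.1 (H s) q.2‖ₑ) := by
  have hc := (hH.slice s).stronglyMeasurable_collapse.measurable
  have hm1 : Measurable fun q : ℝ × ℝ => ENNReal.ofReal (|q.2| ^ r) *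
      if s ≤ q.1 then ‖collapse (q.1 - s) (H s) q.2‖ₑ else 0 := by
    refine Measurable.mul (by fun_prop) (Measurable.ite
      (measurableSet_le measurable_const measurable_fst) ?_ measurable_const)
    exact (hc.comp (by fun_prop : Measurable fun q : ℝ × ℝ => (q.1 - s, q.2))).enorm
  have hm2 : Measurable fun q : ℝ × ℝ =>
      ENNReal.ofReal (|q.2| ^ r) * ‖collapse q.1 (H s) q.2‖ₑ :=
    Measurable.mul (by fun_prop) hc.enorm
  rw [l2n_le_iff, l2n_sq, lintegral_prod_symm' _ (hm1.pow_const 2),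
    lintegral_prod_symm' _ (hm2.pow_const 2)]
  refine lintegral_mono fun ζ => ?_
  rw [← lintegral_indicator measurableSet_Icc, ← lintegral_indicator measurableSet_Icc,
    ← lintegral_sub_right_eq_self (Set.indicator (Set.Icc 0 T) fun t =>
      (ENNReal.ofReal (|ζ| ^ r) * ‖collapse t (H s) ζ‖ₑ) ^ 2) s]
  refine lintegral_mono fun t => ?_
  by_cases ht : t ∈ Set.Icc 0 T ∧ s ≤ t
  · rw [Set.indicator_of_mem ht.1, Set.indicator_of_mem
      (show t - s ∈ Set.Icc 0 T from ⟨by linarith [ht.2], by linarith [ht.1.2]⟩)]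
    simp [ht.2]
  · rw [not_and_or] at ht
    rcases ht with ht | ht
    · simp [ht]
    · simp [Set.indicator, ht]

/-- The collapsing estimate for the Duhamel solution, on the Fourier side, in terms of the data. -/
theorem KernelDecay.duhamel_collapse_le {C C' : ℝ} {h : ℝ → ℝ → ℂ} {H : ℝ → ℝ → ℝ → ℂ}
    (hh : KernelDecay C h) (hH : FamilyDecay C' H) {ε σ T : ℝ}
    (hε : 0 < ε) (hε2 : ε < 1 / 2) (hεσ : ε ≤ σ) (hσ' : σ < 1 / 2) (hT : 0 < T) :
    l2n ((volume.restrict (Set.Icc 0 T)).prod volume) (fun q : ℝ × ℝ =>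
        ENNReal.ofReal (|q.2| ^ (1 / 2 - ε)) * ‖∫ η, duhamelHat h H q.1 (q.2 - η) η‖ₑ) ≤
      ENNReal.ofReal (√(collapseConst σ) * T ^ ((σ + ε) / 2)) *
        (weightedNorm σ h + ∫⁻ s in Set.Icc 0 T, weightedNorm σ (H s)) := by
  set f : ℝ → ℝ × ℝ → ℝ≥0∞ := fun s q => ENNReal.ofReal (|q.2| ^ (1 / 2 - ε)) *
    if s ≤ q.1 then ‖collapse (q.1 - s) (H s) q.2‖ₑ else 0 with hf
  have hfm : Measurable (Function.uncurry f) := by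
    refine Measurable.mul (by fun_prop) (Measurable.ite
      (measurableSet_le measurable_fst (by fun_prop)) ?_ measurable_const)
    exact hH.stronglyMeasurable_collapse.measurable.enorm
  have hm1 : Measurable fun q : ℝ × ℝ =>
      ENNReal.ofReal (|q.2| ^ (1 / 2 - ε)) * ‖collapse q.1 h q.2‖ₑ :=
    Measurable.mul (by fun_prop) hh.stronglyMeasurable_collapse.measurable.enorm
  have hmem : ∀ᵐ q ∂((volume.restrict (Set.Icc 0 T)).prod (volume : Measure ℝ)),
      q.1 ∈ Set.Icc 0 T :=
    Measure.quasiMeasurePreserving_fst.ae (ae_restrict_mem measurableSet_Icc)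
  calc _ ≤ l2n ((volume.restrict (Set.Icc 0 T)).prod volume) (fun q : ℝ × ℝ =>
        ENNReal.ofReal (|q.2| ^ (1 / 2 - ε)) * ‖collapse q.1 h q.2‖ₑ +
          ∫⁻ s in Set.Icc 0 T, f s q) := by
        refine l2n_mono_ae ?_
        filter_upwards [hmem] with q hq
        rw [hf, lintegral_const_mul' _ _ (by simp), ← mul_add,
          integral_antidiag_duhamelHat hh hH hq.1]
        gcongr
        refine (enorm_add_le _ _).trans (add_le_add_right ?_ _)
        rw [enorm_mul, show ‖I‖ₑ = 1 by simp [← ofReal_norm], one_mul]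
        exact enorm_intervalIntegral_le hq.1 hq.2 _
    _ ≤ l2n ((volume.restrict (Set.Icc 0 T)).prod volume) (fun q : ℝ × ℝ =>
        ENNReal.ofReal (|q.2| ^ (1 / 2 - ε)) * ‖collapse q.1 h q.2‖ₑ) +
        ∫⁻ s in Set.Icc 0 T, l2n ((volume.restrict (Set.Icc 0 T)).prod volume) (f s) := by
        refine (l2n_add_le hm1.aemeasurable
          (Measurable.lintegral_prod_left' hfm).aemeasurable).trans ?_
        gcongr
        exact l2n_lintegral_le hfm
    _ ≤ _ := by
        rw [mul_add, ← lintegral_const_mul' _ _ ENNReal.ofReal_ne_top]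
        refine add_le_add (hh.collapse_le hε hε2 hεσ hσ' hT)
          (setLIntegral_mono' measurableSet_Icc fun s hs => ?_)
        exact (hH.collapse_shift_le T _ s hs.1).trans
          ((hH.slice s).collapse_le hε hε2 hεσ hσ' hT)

theorem KernelDecay.weightedNorm_data_le {C C' : ℝ} {h : ℝ → ℝ → ℂ} {H : ℝ → ℝ → ℝ → ℂ}
    (hh : KernelDecay C h) (hH : FamilyDecay C' H) {σ t T : ℝ} (ht0 : 0 ≤ t) (htT : t ≤ T)
    (hT : T ≤ 1) :
    weightedNorm σ h ≤
      weightedNorm σ (duhamelHat h H t) + ∫⁻ s in Set.Icc 0 T, weightedNorm σ (H s) := by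
  set f : ℝ → ℝ × ℝ → ℝ≥0∞ := fun s p =>
    ENNReal.ofReal ((p.1 ^ 2 + p.2 ^ 2) ^ (σ / 2)) * ‖H s p.1 p.2‖ₑ with hf
  have hfm : Measurable (Function.uncurry f) :=
    Measurable.mul (by fun_prop) hH.continuous.measurable.enorm
  have hm1 : Measurable fun p : ℝ × ℝ =>
      ENNReal.ofReal ((p.1 ^ 2 + p.2 ^ 2) ^ (σ / 2)) * ‖duhamelHat h H t p.1 p.2‖ₑ :=
    Measurable.mul (by fun_prop)
      (hh.decay_duhamelHat hH ht0 (htT.trans hT)).continuous.measurable.enorm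
  calc weightedNorm σ h ≤ l2n volume (fun p : ℝ × ℝ =>
        ENNReal.ofReal ((p.1 ^ 2 + p.2 ^ 2) ^ (σ / 2)) * ‖duhamelHat h H t p.1 p.2‖ₑ +
          ∫⁻ s in Set.Icc 0 T, f s p) := by
        refine l2n_mono fun p => ?_
        rw [hf, lintegral_const_mul' _ _ (by simp), ← mul_add]
        gcongr
        have e : cexp (I * ((t * (p.2 ^ 2 - p.1 ^ 2) : ℝ) : ℂ)) * h p.1 p.2 =
            duhamelHat h H t p.1 p.2 - I * ∫ s in (0 : ℝ)..t,
              cexp (I * (((t - s) * (p.2 ^ 2 - p.1 ^ 2) : ℝ) : ℂ)) * H s p.1 p.2 := by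
          rw [duhamelHat]; ring
        rw [← one_mul ‖h p.1 p.2‖ₑ, ← enorm_exp_I_mul (t * (p.2 ^ 2 - p.1 ^ 2)), ← enorm_mul, e]
        refine (enorm_sub_le).trans (add_le_add_right ?_ _)
        rw [enorm_mul, show ‖I‖ₑ = 1 by simp [← ofReal_norm], one_mul]
        refine (enorm_intervalIntegral_le ht0 htT _).trans (lintegral_mono fun s => ?_)
        dsimp only
        rw [enorm_mul, enorm_exp_I_mul, one_mul]
        split_ifs
        · exact le_rfl
        · exact zero_le
    _ ≤ _ := by
        refine (l2n_add_le hm1.aemeasurable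
          (Measurable.lintegral_prod_left' hfm).aemeasurable).trans ?_
        refine add_le_add_right ?_ _
        exact l2n_lintegral_le hfm

theorem enorm_weighted {G : ℝ → ℝ → ℂ} (σ : ℝ) (p : ℝ × ℝ) :
    ‖(((p.1 ^ 2 + p.2 ^ 2) ^ (σ / 2) : ℝ) : ℂ) * G p.1 p.2‖ₑ =
      ENNReal.ofReal ((p.1 ^ 2 + p.2 ^ 2) ^ (σ / 2)) * ‖G p.1 p.2‖ₑ := by
  rw [enorm_mul, ← ofReal_norm, Complex.norm_real, Real.norm_of_nonneg (by positivity)]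

theorem KernelDecay.weightedNorm_lt_top {C : ℝ} {G : ℝ → ℝ → ℂ} (hG : KernelDecay C G) {σ : ℝ}
    (h0 : 0 ≤ σ) (h1 : σ ≤ 1) : weightedNorm σ G < ⊤ := by
  have h := (hG.weighted h0 h1).2
  refine lt_top_iff_ne_top.2 fun htop => ?_
  have hsq : weightedNorm σ G ^ 2 < ⊤ := ?_
  · simp [htop] at hsq
  rw [weightedNorm, l2n_sq]
  simp_rw [← enorm_weighted (G := G)]
  rw [lintegral_enorm_sq_eq_eLpNorm_sq volume
    (fun p : ℝ × ℝ => (((p.1 ^ 2 + p.2 ^ 2) ^ (σ / 2) : ℝ) : ℂ) * G p.1 p.2)]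
  exact ENNReal.pow_lt_top h.eLpNorm_lt_top

/-- Plancherel for the homogeneous Sobolev norm. -/
theorem KernelDecay.L2K_absDxy {C : ℝ} {f G : ℝ → ℝ → ℂ} (hG : KernelDecay C G) (hf : FT2 f = G)
    {σ : ℝ} (h0 : 0 ≤ σ) (h1 : σ ≤ 1) :
    L2K (absDxy σ f) = ENNReal.ofReal (2 * π)⁻¹ * weightedNorm σ G := by
  have h := hG.weighted h0 h1
  have key : L2K (absDxy σ f) ^ 2 = (ENNReal.ofReal (2 * π)⁻¹ * weightedNorm σ G) ^ 2 := by
    rw [L2K, ← lintegral_enorm_sq_eq_eLpNorm_sq, mul_pow, weightedNorm, l2n_sq]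
    unfold absDxy
    rw [hf, lintegral_enorm_sq_IFT2
      (g := fun ξ η => (((ξ ^ 2 + η ^ 2) ^ (σ / 2) : ℝ) : ℂ) * G ξ η) h.1 h.2,
      ← ENNReal.ofReal_pow (by positivity), inv_pow]
    simp_rw [← enorm_weighted (G := G)]
  refine le_antisymm ?_ ?_ <;> rw [← ENNReal.pow_le_pow_left_iff (n := 2) (by norm_num), key]

theorem continuous_IFT2 {g : ℝ → ℝ → ℂ} (hg : Integrable fun p : ℝ × ℝ => g p.1 p.2) :
    Continuous fun p : ℝ × ℝ => IFT2 g p.1 p.2 := by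
  simp_rw [IFT2_eq_integral_prod hg]
  refine Continuous.const_mul ?_ _
  refine continuous_of_dominated (bound := fun p : ℝ × ℝ => ‖g p.1 p.2‖) ?_ ?_ hg.norm ?_
  · exact fun q => (integrable_phase_mul hg (by fun_prop)).aestronglyMeasurable
  · refine fun q => Filter.Eventually.of_forall fun p => ?_
    rw [norm_mul, mul_comm I, Complex.norm_exp_ofReal_mul_I, one_mul]
  · exact Filter.Eventually.of_forall fun p => by fun_prop

theorem IFT2_diag {C : ℝ} {G : ℝ → ℝ → ℂ} (hG : KernelDecay C G) (x : ℝ) :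
    IFT2 G x x = IFT1 (fun ζ => (2 * (π : ℂ))⁻¹ * ∫ η, G (ζ - η) η) x := by
  set Φ : ℝ × ℝ → ℂ := fun p => cexp (I * ((p.1 * x + p.2 * x : ℝ) : ℂ)) * G p.1 p.2 with hΦ
  have hΦi : Integrable Φ := integrable_phase_mul hG.integrable (by fun_prop)
  have hmp : MeasurePreserving (fun q : ℝ × ℝ => (q.1 - q.2, q.2)) := by
    exact measurePreserving_sub_prod volume volume
  have hcomp : Integrable fun q : ℝ × ℝ => Φ (q.1 - q.2, q.2) :=
    (hmp.integrable_comp hΦi.aestronglyMeasurable).2 hΦi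
  have hchange : ∫ p, Φ p = ∫ q : ℝ × ℝ, Φ (q.1 - q.2, q.2) := by
    rw [← integral_map hmp.measurable.aemeasurable (by rw [hmp.map_eq]; exact hΦi.1), hmp.map_eq]
  rw [IFT2_eq_integral_prod hG.integrable, hchange, Measure.volume_eq_prod, integral_prod _ hcomp,
    IFT1,
    sq, mul_inv, mul_assoc, ← integral_const_mul]
  congr 2; ext ζ
  rw [← mul_assoc, mul_comm (cexp _), mul_assoc, ← integral_const_mul (cexp _)]
  congr 2; ext η
  simp only [hΦ]
  congr 2; push_cast; ring

/-- The Fourier transform of the density. -/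
theorem FT1_diag {C C' : ℝ} {G : ℝ → ℝ → ℂ} (hG : KernelDecay C G)
    (hΓ : KernelDecay C' (IFT2 G)) :
    FT1 (fun x => IFT2 G x x) = fun ζ => (2 * (π : ℂ))⁻¹ * ∫ η, G (ζ - η) η := by
  have hd := hΓ.integrable_diag
  simp_rw [IFT2_diag hG] at hd ⊢
  refine FT1_IFT1 (hG.continuous_integral_antidiag.const_mul _) ?_ hd
  simpa using (hG.weighted_integral_antidiag le_rfl zero_le_one (2 * (π : ℂ))⁻¹).1

theorem lintegral_absDx_diag_le {C C' : ℝ} {G : ℝ → ℝ → ℂ} (hG : KernelDecay C G)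
    (hΓ : KernelDecay C' (IFT2 G)) {r : ℝ} (h0 : 0 ≤ r) (h1 : r ≤ 1) :
    ∫⁻ x, ‖absDx r (fun a => IFT2 G a a) x‖ₑ ^ 2 ≤
      ∫⁻ ζ, (ENNReal.ofReal (|ζ| ^ r) * ‖∫ η, G (ζ - η) η‖ₑ) ^ 2 := by
  have hw := hG.weighted_integral_antidiag h0 h1 (2 * (π : ℂ))⁻¹
  have hpi : (2 * π)⁻¹ ≤ 1 := inv_le_one_of_one_le₀ (by linarith [Real.pi_gt_three])
  have hpi' : ENNReal.ofReal (2 * π)⁻¹ ≤ 1 := by simpa using ENNReal.ofReal_le_ofReal hpi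
  unfold absDx
  rw [FT1_diag hG hΓ, lintegral_enorm_sq_IFT1 hw.1 hw.2]
  refine (mul_le_of_le_one_left' hpi').trans (lintegral_mono fun ζ => ?_)
  dsimp only
  rw [enorm_mul, enorm_mul, ← ofReal_norm, Complex.norm_real, Real.norm_of_nonneg (by positivity)]
  gcongr
  refine mul_le_of_le_one_left' ?_
  rw [← ofReal_norm, norm_inv]
  simpa [abs_of_pos Real.pi_pos] using hpi'

theorem continuous_duhamelHat {C C' : ℝ} {h : ℝ → ℝ → ℂ} {H : ℝ → ℝ → ℝ → ℂ}
    (hh : KernelDecay C h) (hH : FamilyDecay C' H) :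
    Continuous fun q : ℝ × ℝ × ℝ => duhamelHat h H q.1 q.2.1 q.2.2 := by
  have h1 := hh.continuous.comp (continuous_snd : Continuous fun q : ℝ × ℝ × ℝ => q.2)
  have h2 := hH.continuous.comp
    (by fun_prop : Continuous fun q : (ℝ × ℝ × ℝ) × ℝ => (q.2, q.1.2.1, q.1.2.2))
  refine Continuous.add (Continuous.mul (by fun_prop) h1) (Continuous.const_mul ?_ I)
  exact intervalIntegral.continuous_parametric_intervalIntegral_of_continuous
    (f := fun (q : ℝ × ℝ × ℝ) s =>
      cexp (I * (((q.1 - s) * (q.2.2 ^ 2 - q.2.1 ^ 2) : ℝ) : ℂ)) * H s q.2.1 q.2.2)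
    (Continuous.mul (by fun_prop) h2) continuous_fst

theorem measurable_integral_antidiag_duhamelHat {C C' : ℝ} {h : ℝ → ℝ → ℂ} {H : ℝ → ℝ → ℝ → ℂ}
    (hh : KernelDecay C h) (hH : FamilyDecay C' H) :
    Measurable fun q : ℝ × ℝ => ∫ η, duhamelHat h H q.1 (q.2 - η) η := by
  have hc := (continuous_duhamelHat hh hH).comp
    (by fun_prop : Continuous fun q : (ℝ × ℝ) × ℝ => (q.1.1, q.1.2 - q.2, q.2))
  exact (StronglyMeasurable.integral_prod_right' hc.stronglyMeasurable).measurable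

theorem MixedN2_two_sq_le (μ : Measure ℝ) (u : ℝ → ℝ → ℂ) :
    MixedN2 μ 2 2 u ^ 2 ≤ ∫⁻ t, ∫⁻ x, ‖u t x‖ₑ ^ 2 ∂volume ∂μ := by
  rw [MixedN2, ← lintegral_enorm_sq_eq_eLpNorm_sq]
  refine lintegral_mono fun t => ?_
  rw [lintegral_enorm_sq_eq_eLpNorm_sq]
  gcongr
  rw [Real.enorm_of_nonneg ENNReal.toReal_nonneg]
  exact ENNReal.ofReal_toReal_le

theorem freeGamma_eq_IFT2 (f : ℝ → ℝ → ℂ) (τ : ℝ) :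
    freeGamma f τ =
      IFT2 fun ξ η => cexp (I * ((τ * (η ^ 2 - ξ ^ 2) : ℝ) : ℂ)) * FT2 f ξ η := by
  ext x y
  unfold freeGamma
  congr 1; ext ξ η
  congr 2; push_cast; ring

theorem SchwartzBdd.exists_freeGamma_bound {ι : Type*} {f : ι → 𝓢(ℝ × ℝ, ℂ)}
    (hf : SchwartzBdd f) : ∃ C : ℝ, ∀ i τ, |τ| ≤ 1 → ∀ x y,
      ‖freeGamma (fun a b => f i (a, b)) τ x y‖ ≤
        C * (((1 + x ^ 2) ^ 3)⁻¹ * ((1 + y ^ 2) ^ 3)⁻¹) := by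
  have h1 : SchwartzBdd fun j : ι × {τ : ℝ // |τ| ≤ 1} => f j.1 := fun k n => by
    obtain ⟨C, hC⟩ := hf k n
    exact ⟨C, fun j => hC j.1⟩
  have h2 := ((h1.map FT2CLM).smulLeft_phaseMul (τ := fun j => j.2.1) (fun j => j.2.2)).map IFT2CLM
  obtain ⟨C, -, hC⟩ := h2.exists_bound
  refine ⟨‖((2 * (π : ℂ)) ^ 2)⁻¹‖ * C, fun i τ hτ x y => ?_⟩
  have e : freeGamma (fun a b => f i (a, b)) τ x y = ((2 * (π : ℂ)) ^ 2)⁻¹ *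
      IFT2CLM (smulLeftCLM ℂ (phaseMul τ) (FT2CLM (f i))) (x, y) := by
    rw [IFT2CLM_apply, freeGamma_eq_IFT2]
    congr 1; ext ξ η
    rw [smulLeftCLM_apply_apply (hasTemperateGrowth_phaseMul τ), FT2CLM_apply]
    rfl
  rw [e, norm_mul, mul_assoc]
  gcongr
  exact hC (i, ⟨τ, hτ⟩) x y

theorem SchwartzMap.kernelDecay_FT2 (f : 𝓢(ℝ × ℝ, ℂ)) :
    ∃ C, KernelDecay C (FT2 fun a b => f (a, b)) := by
  have h0 : SchwartzBdd fun _ : Unit => f := fun k n => ⟨_, fun _ => le_rfl⟩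
  obtain ⟨C, -, hC⟩ := (h0.map FT2CLM).exists_bound
  refine ⟨C, ?_, fun ξ η => ?_⟩
  · exact (FT2CLM f).continuous.congr fun p => FT2CLM_apply f p
  · simpa [FT2CLM_apply] using hC () ξ η

theorem SchwartzMap.familyDecay_FT2 (F : 𝓢(ℝ × ℝ × ℝ, ℂ)) :
    ∃ C, FamilyDecay C fun s => FT2 fun a b => F (s, a, b) := by
  obtain ⟨C, -, hC⟩ := ((schwartzBdd_slice F).map FT2CLM).exists_bound
  refine ⟨C, ?_, fun s ξ η => ?_⟩
  · obtain ⟨B, hB0, hB⟩ := (schwartzBdd_slice F).exists_bound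
    have hi : ∀ s, Integrable fun p : ℝ × ℝ => F (s, p.1, p.2) := fun s =>
      (schwartzSlice s F).integrable
    simp_rw [fun s => FT2_eq_integral_prod (f := fun a b => F (s, a, b)) (hi s)]
    refine continuous_of_dominated
      (bound := fun p : ℝ × ℝ => B * ((1 + p.1 ^ 2)⁻¹ * (1 + p.2 ^ 2)⁻¹)) ?_ ?_
      (integrable_inv_one_add_sq_prod.const_mul B) ?_
    · exact fun q => (integrable_phase_mul (hi q.1) (by fun_prop)).aestronglyMeasurable
    · refine fun q => Filter.Eventually.of_forall fun p => ?_
      rw [norm_mul, mul_comm I, Complex.norm_exp_ofReal_mul_I, one_mul]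
      refine (hB q.1 p.1 p.2).trans ?_
      gcongr <;> exact le_self_pow₀ (by nlinarith [sq_nonneg p.1, sq_nonneg p.2]) (by norm_num)
    · refine Filter.Eventually.of_forall fun p => ?_
      have := F.continuous
      fun_prop
  · simpa [FT2CLM_apply, schwartzSlice_apply] using hC s ξ η

/-- The Duhamel solution is the inverse Fourier transform of `duhamelHat`. -/
theorem duhamelGamma_eq_IFT2 {C C' : ℝ} {f : ℝ → ℝ → ℂ} {F : ℝ → ℝ → ℝ → ℂ}
    (hh : KernelDecay C (FT2 f)) (hH : FamilyDecay C' fun s => FT2 (F s)) {t : ℝ} (ht0 : 0 ≤ t)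
    (ht1 : t ≤ 1) :
    duhamelGamma f F t = IFT2 (duhamelHat (FT2 f) (fun s => FT2 (F s)) t) := by
  ext x y
  have hp0 := hh.phase_mul (θ := fun ξ η => t * (η ^ 2 - ξ ^ 2)) (by fun_prop)
  have hp := hH.phase_mul (θ := fun s ξ η => (t - s) * (η ^ 2 - ξ ^ 2)) (by fun_prop)
  have hq := hp.phase_mul (θ := fun _ ξ η => ξ * x + η * y) (by fun_prop)
  have hsw := integral_intervalIntegral_swap_of_bound (μ := (volume : Measure (ℝ × ℝ))) ht0
    (K := fun s p => cexp (I * ((p.1 * x + p.2 * y : ℝ) : ℂ)) *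
      (cexp (I * (((t - s) * (p.2 ^ 2 - p.1 ^ 2) : ℝ) : ℂ)) * FT2 (F s) p.1 p.2))
    hq.continuous.stronglyMeasurable (integrable_inv_one_add_sq_prod.const_mul C')
    (fun s p => (hq.slice s).bound' p.1 p.2)
  have hfree : ∀ s, freeGamma (F s) (t - s) x y = ((2 * (π : ℂ)) ^ 2)⁻¹ *
      ∫ p : ℝ × ℝ, cexp (I * ((p.1 * x + p.2 * y : ℝ) : ℂ)) *
        (cexp (I * (((t - s) * (p.2 ^ 2 - p.1 ^ 2) : ℝ) : ℂ)) * FT2 (F s) p.1 p.2) := fun s => by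
    rw [freeGamma_eq_IFT2, IFT2_eq_integral_prod (hp.slice s).integrable]
  rw [IFT2_eq_integral_prod (hh.decay_duhamelHat hH ht0 ht1).integrable, duhamelGamma,
    freeGamma_eq_IFT2, IFT2_eq_integral_prod hp0.integrable]
  simp_rw [hfree]
  rw [intervalIntegral.integral_const_mul, ← hsw.2]
  simp_rw [intervalIntegral.integral_const_mul]
  have hi := hsw.1
  simp_rw [intervalIntegral.integral_const_mul] at hi
  unfold duhamelHat
  simp_rw [mul_add]
  rw [integral_add, mul_add]
  · congr 1
    rw [← mul_assoc, mul_comm I, mul_assoc, ← integral_const_mul]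
    congr 2; ext p; ring
  · exact integrable_phase_mul hp0.integrable (by fun_prop)
  · refine (hi.const_mul I).congr (Filter.Eventually.of_forall fun p => ?_)
    dsimp only
    ring

theorem exists_kernelDecay_duhamelGamma (f : 𝓢(ℝ × ℝ, ℂ)) (F : 𝓢(ℝ × ℝ × ℝ, ℂ)) :
    ∃ C : ℝ, ∀ t : ℝ, 0 ≤ t → t ≤ 1 →
      KernelDecay C (duhamelGamma (fun a b => f (a, b)) (fun s a b => F (s, a, b)) t) := by
  have h0 : SchwartzBdd fun _ : Unit => f := fun k n => ⟨_, fun _ => le_rfl⟩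
  obtain ⟨C₁, hC₁⟩ := h0.exists_freeGamma_bound
  obtain ⟨C₂, hC₂⟩ := (schwartzBdd_slice F).exists_freeGamma_bound
  obtain ⟨B, hB⟩ := f.kernelDecay_FT2
  obtain ⟨B', hB'⟩ := F.familyDecay_FT2
  refine ⟨C₁ + C₂, fun t ht0 ht1 => ⟨?_, fun x y => ?_⟩⟩
  · rw [duhamelGamma_eq_IFT2 hB hB' ht0 ht1]
    exact continuous_IFT2 (hB.decay_duhamelHat hB' ht0 ht1).integrable
  · rw [add_mul]
    refine (norm_add_le _ _).trans (add_le_add (hC₁ () t (by rwa [abs_of_nonneg ht0]) x y) ?_)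
    rw [norm_mul, norm_I, one_mul]
    have hb : ∀ s ∈ Set.uIoc 0 t, ‖freeGamma (fun a b => F (s, a, b)) (t - s) x y‖ ≤
        C₂ * (((1 + x ^ 2) ^ 3)⁻¹ * ((1 + y ^ 2) ^ 3)⁻¹) := by
      intro s hs
      rw [Set.uIoc_of_le ht0] at hs
      exact hC₂ s (t - s) (by rw [abs_of_nonneg] <;> linarith [hs.1, hs.2]) x y
    refine (intervalIntegral.norm_integral_le_of_norm_le_const hb).trans ?_
    rw [sub_zero, abs_of_nonneg ht0]
    refine mul_le_of_le_one_right ?_ ht1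
    exact (norm_nonneg _).trans (hC₂ 0 0 (by simp) x y)

theorem exists_mem_Icc_enorm_le {T : ℝ} (hT : 0 < T) (f : ℝ → ℝ) :
    ∃ t ∈ Set.Icc 0 T, ‖f t‖ₑ ≤ eLpNorm f ⊤ (volume.restrict (Set.Icc 0 T)) := by
  have : (ae (volume.restrict (Set.Icc 0 T))).NeBot := by
    rw [ae_neBot, Ne, Measure.restrict_eq_zero, Real.volume_Icc]
    simpa using hT
  rw [eLpNorm_exponent_top]
  obtain ⟨t, h1, h2⟩ := ((ae_restrict_mem measurableSet_Icc).and
    (enorm_ae_le_eLpNormEssSup f (volume.restrict (Set.Icc 0 T)))).exists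
  exact ⟨t, h1, h2⟩

/-- The collapsing estimate for the Duhamel solution in terms of the Fourier transforms of the
data. -/
theorem MixedN2_density_le (Γ₀ : 𝓢(ℝ × ℝ, ℂ)) (F : 𝓢(ℝ × ℝ × ℝ, ℂ)) {ε σ T : ℝ}
    (hε : 0 < ε) (hε2 : ε < 1 / 2) (hεσ : ε ≤ σ) (hσ' : σ < 1 / 2) (hT : 0 < T) (hT1 : T ≤ 1) :
    MixedN2 (volume.restrict (Set.Icc 0 T)) 2 2 (fun t x => absDx (1 / 2 - ε) (fun a =>
        duhamelGamma (fun a b => Γ₀ (a, b)) (fun s a b => F (s, a, b)) t a a) x) ≤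
      ENNReal.ofReal (√(collapseConst σ) * T ^ ((σ + ε) / 2)) *
        (weightedNorm σ (FT2 fun a b => Γ₀ (a, b)) +
          ∫⁻ s in Set.Icc 0 T, weightedNorm σ (FT2 fun a b => F (s, a, b))) := by
  obtain ⟨C, hh⟩ := Γ₀.kernelDecay_FT2
  obtain ⟨C', hH⟩ := F.familyDecay_FT2
  obtain ⟨B, hB⟩ := exists_kernelDecay_duhamelGamma Γ₀ F
  refine le_trans ?_ (hh.duhamel_collapse_le hH hε hε2 hεσ hσ' hT)
  rw [← ENNReal.pow_le_pow_left_iff (n := 2) (by norm_num), l2n_sq]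
  refine (MixedN2_two_sq_le _ _).trans ?_
  rw [lintegral_prod]
  · refine setLIntegral_mono' measurableSet_Icc fun t ht => ?_
    have hG := hB t ht.1 (ht.2.trans hT1)
    rw [duhamelGamma_eq_IFT2 hh hH ht.1 (ht.2.trans hT1)] at hG ⊢
    exact lintegral_absDx_diag_le (hh.decay_duhamelHat hH ht.1 (ht.2.trans hT1)) hG
      (by linarith) (by linarith)
  · exact ((Measurable.mul (by fun_prop)
      (measurable_integral_antidiag_duhamelHat hh hH).enorm).pow_const 2).aemeasurable

theorem weightedNorm_FT2_eq {f : ℝ → ℝ → ℂ} {C : ℝ} (hf : KernelDecay C (FT2 f)) {σ : ℝ}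
    (h0 : 0 ≤ σ) (h1 : σ ≤ 1) :
    weightedNorm σ (FT2 f) = ENNReal.ofReal (2 * π) * L2K (absDxy σ f) := by
  rw [hf.L2K_absDxy rfl h0 h1, ← mul_assoc, ← ENNReal.ofReal_mul (by positivity),
    mul_inv_cancel₀ (by positivity), ENNReal.ofReal_one, one_mul]

/-- The Sobolev norm of the initial data is controlled by that of the solution and the forcing. -/
theorem weightedNorm_data_le_eLpNorm (Γ₀ : 𝓢(ℝ × ℝ, ℂ)) (F : 𝓢(ℝ × ℝ × ℝ, ℂ)) {σ T : ℝ}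
    (h0 : 0 ≤ σ) (h1 : σ ≤ 1) (hT : 0 < T) (hT1 : T ≤ 1) :
    weightedNorm σ (FT2 fun a b => Γ₀ (a, b)) ≤ ENNReal.ofReal (2 * π) *
      eLpNorm (fun t => (L2K (absDxy σ
        (duhamelGamma (fun a b => Γ₀ (a, b)) (fun s a b => F (s, a, b)) t))).toReal) ⊤
          (volume.restrict (Set.Icc 0 T)) +
      ∫⁻ s in Set.Icc 0 T, weightedNorm σ (FT2 fun a b => F (s, a, b)) := by
  obtain ⟨C, hh⟩ := Γ₀.kernelDecay_FT2
  obtain ⟨C', hH⟩ := F.familyDecay_FT2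
  obtain ⟨B, hB⟩ := exists_kernelDecay_duhamelGamma Γ₀ F
  obtain ⟨t, ht, hle⟩ := exists_mem_Icc_enorm_le hT (fun t => (L2K (absDxy σ
    (duhamelGamma (fun a b => Γ₀ (a, b)) (fun s a b => F (s, a, b)) t))).toReal)
  refine (hh.weightedNorm_data_le hH ht.1 ht.2 hT1).trans (add_le_add_left ?_ _)
  refine le_trans ?_ (mul_le_mul_right hle _)
  have hΓ := hB t ht.1 (ht.2.trans hT1)
  have hd := hh.decay_duhamelHat hH ht.1 (ht.2.trans hT1)
  have hFT : FT2 (duhamelGamma (fun a b => Γ₀ (a, b)) (fun s a b => F (s, a, b)) t) =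
      duhamelHat (FT2 fun a b => Γ₀ (a, b)) (fun s => FT2 fun a b => F (s, a, b)) t := by
    rw [duhamelGamma_eq_IFT2 hh hH ht.1 (ht.2.trans hT1)] at hΓ ⊢
    exact FT2_IFT2 hd.continuous hd.integrable hΓ.integrable
  have hw := weightedNorm_FT2_eq (by rwa [hFT]) h0 h1
  have hfin : L2K (absDxy σ
      (duhamelGamma (fun a b => Γ₀ (a, b)) (fun s a b => F (s, a, b)) t)) ≠ ⊤ := by
    rw [hd.L2K_absDxy hFT h0 h1]
    exact ENNReal.mul_ne_top ENNReal.ofReal_ne_top (hd.weightedNorm_lt_top h0 h1).ne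
  rw [Real.enorm_of_nonneg ENNReal.toReal_nonneg, ENNReal.ofReal_toReal hfin, ← hw, hFT]

/-- Inhomogeneous perturbed collapsing estimate, `σ = (3/2−ε)ε`. -/
theorem inhomogeneous_perturbed_collapsing (ε : ℝ) (hε0 : 0 < ε) (hε : ε < 1/2) :
    ∃ C c : ℝ, 0 < C ∧ 0 < c ∧ ∀ T : ℝ, 0 < T → T ≤ 1 →
      ∀ Γ₀ : 𝓢(ℝ × ℝ, ℂ), ∀ F : 𝓢(ℝ × ℝ × ℝ, ℂ), ∀ Γ : ℝ → ℝ → ℝ → ℂ,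
      Γ = duhamelGamma (fun a b => Γ₀ (a, b)) (fun s a b => F (s, a, b)) →
      MixedN2 (volume.restrict (Set.Icc (0:ℝ) T)) 2 2
          (fun t x => absDx (1/2 - ε) (fun a => Γ t a a) x)
        ≤ ENNReal.ofReal (C * T ^ c) *
            (eLpNorm (fun t => (L2K (absDxy ((3/2 - ε) * ε) (Γ t))).toReal) ⊤
                (volume.restrict (Set.Icc (0:ℝ) T)) +
              ∫⁻ s in Set.Icc (0:ℝ) T,
                L2K (absDxy ((3/2 - ε) * ε) (fun a b => F (s, a, b)))) := by
  have hεσ : ε ≤ (3 / 2 - ε) * ε := by nlinarith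
  have hσ' : (3 / 2 - ε) * ε < 1 / 2 := by nlinarith
  generalize (3 / 2 - ε) * ε = σ at hεσ hσ' ⊢
  have hK : 0 < √(collapseConst σ) := Real.sqrt_pos.2 (collapseConst_pos hσ')
  refine ⟨√(collapseConst σ) * (4 * π), (σ + ε) / 2, by positivity, by linarith, ?_⟩
  rintro T hT hT1 Γ₀ F Γ rfl
  obtain ⟨C', hH⟩ := F.familyDecay_FT2
  have hσ0 : 0 ≤ σ := by linarith
  have hσ1 : σ ≤ 1 := by linarith
  have hF : ∫⁻ s in Set.Icc 0 T, weightedNorm σ (FT2 fun a b => F (s, a, b)) =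
      ENNReal.ofReal (2 * π) * ∫⁻ s in Set.Icc 0 T, L2K (absDxy σ fun a b => F (s, a, b)) := by
    rw [← lintegral_const_mul' _ _ ENNReal.ofReal_ne_top]
    exact lintegral_congr fun s => weightedNorm_FT2_eq (hH.slice s) hσ0 hσ1
  have hdata := weightedNorm_data_le_eLpNorm Γ₀ F hσ0 hσ1 hT hT1
  refine (MixedN2_density_le Γ₀ F hε0 hε hεσ hσ' hT hT1).trans ?_
  rw [hF] at hdata ⊢
  set N := eLpNorm (fun t => (L2K (absDxy σ
    (duhamelGamma (fun a b => Γ₀ (a, b)) (fun s a b => F (s, a, b)) t))).toReal) ⊤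
      (volume.restrict (Set.Icc 0 T))
  set S := ∫⁻ s in Set.Icc 0 T, L2K (absDxy σ fun a b => F (s, a, b))
  have hconst : ENNReal.ofReal (√(collapseConst σ) * (4 * π) * T ^ ((σ + ε) / 2)) =
      ENNReal.ofReal (√(collapseConst σ) * T ^ ((σ + ε) / 2)) * (ENNReal.ofReal (2 * π) * 2) := by
    rw [← ENNReal.ofReal_ofNat 2, ← ENNReal.ofReal_mul (by positivity),
      ← ENNReal.ofReal_mul (by positivity)]
    congr 1; ring
  rw [hconst, mul_assoc]
  gcongr
  calc weightedNorm σ (FT2 fun a b => Γ₀ (a, b)) + ENNReal.ofReal (2 * π) * S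
      ≤ ENNReal.ofReal (2 * π) * N + ENNReal.ofReal (2 * π) * S + ENNReal.ofReal (2 * π) * S := by
        gcongr
    _ = ENNReal.ofReal (2 * π) * (N + 2 * S) := by ring
    _ ≤ ENNReal.ofReal (2 * π) * 2 * (N + S) := by
        rw [mul_assoc, mul_add 2]
        gcongr
        exact le_mul_of_one_le_left zero_le one_le_two

end
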